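/- arXiv:2501.00998 — 2 statements merged into one kernel-verified Lean document; each statement's English description precedes it below -/
import Mathlib

section
/- There exists n0 such that for every n ≥ n0 the following holds. Let 𝒢 = {G_1, …, G_n} be a collection of (undirected) graphs on a common vertex set V of size n. If δ(G_i) ≥ n/2 for all i ∈ [n], then 𝒢 contains a transversal Hamilton cycle: a Hamilton cycle H on V together with a bijection φ : E(H) → [n] with e ∈ E(G_{φ(e)}) for every e ∈ E(H). -/
/-- Degree of a vertex in a simple graph on `Fin n`. -/
noncomputable def degS {n : ℕ} (G : SimpleGraph (Fin n)) (v : Fin n) : ℕ :=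
  Nat.card {w : Fin n // G.Adj v w}

/-- `v 0, …, v (ℓ - 1)` is a path whose edge `v t v (t + 1)` lies in `G (c t)`, with distinct
colours `c t`. -/
structure RainbowPath {V K : Type*} (G : K → SimpleGraph V) (ℓ : ℕ) (v : ℕ → V) (c : ℕ → K) :
    Prop where
  inj : ∀ s t, s < ℓ → t < ℓ → v s = v t → s = t
  cinj : ∀ s t, s + 1 < ℓ → t + 1 < ℓ → c s = c t → s = t
  adj : ∀ t, t + 1 < ℓ → (G (c t)).Adj (v t) (v (t + 1))

/-- `v 0, …, v (ℓ - 1)` is a cycle whose edge `v t v (t + 1)` (indices modulo `ℓ`) lies in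
`G (c t)`, with distinct colours `c t`. -/
structure RainbowCycle {V K : Type*} (G : K → SimpleGraph V) (ℓ : ℕ) (v : ℕ → V) (c : ℕ → K) :
    Prop where
  inj : ∀ s t, s < ℓ → t < ℓ → v s = v t → s = t
  cinj : ∀ s t, s < ℓ → t < ℓ → c s = c t → s = t
  adj : ∀ t, t + 1 < ℓ → (G (c t)).Adj (v t) (v (t + 1))
  last : (G (c (ℓ - 1))).Adj (v (ℓ - 1)) (v 0)

/-- A rainbow cycle indexed by `ZMod m`. -/
structure CyclicRainbow {V K : Type*} (G : K → SimpleGraph V) (m : ℕ) (v : ZMod m → V)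
    (c : ZMod m → K) : Prop where
  inj : Function.Injective v
  cinj : Function.Injective c
  adj : ∀ i, (G (c i)).Adj (v i) (v (i + 1))

section

variable {V K : Type*} {G : K → SimpleGraph V}

namespace RainbowPath

variable {ℓ : ℕ} {v : ℕ → V} {c : ℕ → K}

/-- Closing a path into a cycle by removing its edge number `i` and joining each endpoint to the
far end of the removed edge. -/
theorem close (h : RainbowPath G ℓ v c) {i : ℕ} (hi : i + 1 < ℓ) {α β : K} (hαβ : α ≠ β)
    (hα : ∀ t, t + 1 < ℓ → t ≠ i → c t ≠ α) (hβ : ∀ t, t + 1 < ℓ → t ≠ i → c t ≠ β)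
    (h₁ : (G α).Adj (v 0) (v (i + 1))) (h₂ : (G β).Adj (v (ℓ - 1)) (v i)) :
    ∃ w e, RainbowCycle G ℓ w e := by
  refine ⟨fun t => if t ≤ i then v t else v (ℓ + i - t),
    fun t => if t < i then c t else if t = i then β else
      if t + 1 < ℓ then c (ℓ + i - 1 - t) else α, ?_, ?_, ?_, ?_⟩
  · intro s t hs ht hst
    split_ifs at hst <;> have := h.inj _ _ (by omega) (by omega) hst <;> omega
  · intro s t hs ht hst
    split_ifs at hst <;> first
      | omega
      | exact absurd hst hαβ
      | exact absurd hst.symm hαβ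
      | exact absurd hst (hα _ (by omega) (by omega))
      | exact absurd hst.symm (hα _ (by omega) (by omega))
      | exact absurd hst (hβ _ (by omega) (by omega))
      | exact absurd hst.symm (hβ _ (by omega) (by omega))
      | (have := h.cinj _ _ (by omega) (by omega) hst; omega)
  · intro t ht
    rcases lt_trichotomy t i with hti | hti | hti
    · rw [if_pos hti, if_pos hti.le, if_pos (by omega)]
      exact h.adj t (by omega)
    · subst hti
      rw [if_neg (lt_irrefl t), if_pos rfl, if_pos le_rfl, if_neg (by omega),
        show ℓ + t - (t + 1) = ℓ - 1 by omega]
      exact h₂.symm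
    · rw [if_neg (by omega), if_neg (by omega), if_pos ht, if_neg (by omega), if_neg (by omega)]
      have := (h.adj (ℓ + i - 1 - t) (by omega)).symm
      rw [show ℓ + i - 1 - t + 1 = ℓ + i - t by omega] at this
      rwa [show ℓ + i - (t + 1) = ℓ + i - 1 - t by omega]
  · rw [if_neg (by omega), if_neg (by omega), if_neg (by omega), if_neg (by omega),
      if_pos (Nat.zero_le i), show ℓ + i - (ℓ - 1) = i + 1 by omega]
    exact h₁.symm

theorem cons (h : RainbowPath G ℓ v c) {x : V} {z : K} (hx : ∀ t, t < ℓ → v t ≠ x)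
    (hz : ∀ t, t + 1 < ℓ → c t ≠ z) (hxz : 0 < ℓ → (G z).Adj x (v 0)) :
    RainbowPath G (ℓ + 1) (fun t => if t = 0 then x else v (t - 1))
      (fun t => if t = 0 then z else c (t - 1)) := by
  refine ⟨fun s t hs ht hst => ?_, fun s t hs ht hst => ?_, fun t ht => ?_⟩
  · split_ifs at hst
    · omega
    · exact absurd hst.symm (hx _ (by omega))
    · exact absurd hst (hx _ (by omega))
    · have := h.inj _ _ (by omega) (by omega) hst
      omega
  · split_ifs at hst
    · omega
    · exact absurd hst.symm (hz _ (by omega))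
    · exact absurd hst (hz _ (by omega))
    · have := h.cinj _ _ (by omega) (by omega) hst
      omega
  · rcases t with _ | t
    · simpa using hxz (by omega)
    · simpa using h.adj t (by omega)

theorem reverse (h : RainbowPath G ℓ v c) :
    RainbowPath G ℓ (fun t => v (ℓ - 1 - t)) (fun t => c (ℓ - 2 - t)) := by
  refine ⟨fun s t hs ht hst => ?_, fun s t hs ht hst => ?_, fun t ht => ?_⟩
  · have := h.inj _ _ (by omega) (by omega) hst
    omega
  · have := h.cinj _ _ (by omega) (by omega) hst
    omega
  · have := (h.adj (ℓ - 2 - t) (by omega)).symm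
    rw [show ℓ - 2 - t + 1 = ℓ - 1 - t by omega] at this
    rwa [show ℓ - 1 - (t + 1) = ℓ - 2 - t by omega]

theorem tail (h : RainbowPath G (ℓ + 1) v c) :
    RainbowPath G ℓ (fun t => v (t + 1)) (fun t => c (t + 1)) := by
  refine ⟨fun s t hs ht hst => ?_, fun s t hs ht hst => ?_, fun t ht => h.adj _ (by omega)⟩
  · have := h.inj _ _ (by omega) (by omega) hst
    omega
  · have := h.cinj _ _ (by omega) (by omega) hst
    omega

end RainbowPath

namespace RainbowCycle

variable {m : ℕ} {v : ℕ → V} {c : ℕ → K}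

theorem toPath (h : RainbowCycle G m v c) : RainbowPath G m v c :=
  ⟨h.inj, fun s t hs ht => h.cinj s t (by omega) (by omega), h.adj⟩

theorem toCyclic [NeZero m] (h : RainbowCycle G m v c) :
    CyclicRainbow G m (fun i => v i.val) (fun i => c i.val) := by
  refine ⟨fun i j hij => ZMod.val_injective m (h.inj _ _ i.val_lt j.val_lt hij),
    fun i j hij => ZMod.val_injective m (h.cinj _ _ i.val_lt j.val_lt hij), fun i => ?_⟩
  have hi := i.val_lt
  have hval : (i + 1).val = (i.val + 1) % m := by
    rw [← ZMod.val_natCast, Nat.cast_add, ZMod.natCast_zmod_val, Nat.cast_one]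
  by_cases hlt : i.val + 1 < m
  · simp only [hval, Nat.mod_eq_of_lt hlt]
    exact h.adj _ hlt
  · have him : i.val + 1 = m := by omega
    simp only [hval, him, Nat.mod_self]
    rw [show i.val = m - 1 by omega]
    exact h.last

end RainbowCycle

theorem CyclicRainbow.rotate {m : ℕ} [NeZero m] {v : ZMod m → V} {c : ZMod m → K}
    (h : CyclicRainbow G m v c) (s : ZMod m) :
    RainbowCycle G m (fun t => v (s + t)) (fun t => c (s + t)) := by
  have key : ∀ a b : ℕ, a < m → b < m → s + (a : ZMod m) = s + b → a = b := by
    intro a b ha hb hab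
    have := congrArg ZMod.val (add_left_cancel hab)
    rwa [ZMod.val_natCast, ZMod.val_natCast, Nat.mod_eq_of_lt ha, Nat.mod_eq_of_lt hb] at this
  refine ⟨fun a b ha hb hab => key a b ha hb (h.inj hab),
    fun a b ha hb hab => key a b ha hb (h.cinj hab), fun t _ => ?_, ?_⟩
  · have := h.adj (s + t)
    rwa [add_assoc, ← Nat.cast_succ] at this
  · have := h.adj (s + (m - 1 : ℕ))
    rwa [add_assoc, ← Nat.cast_succ, Nat.succ_eq_add_one,
      Nat.sub_add_cancel (NeZero.one_le : 1 ≤ m), ZMod.natCast_self, ← Nat.cast_zero] at this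


namespace RainbowCycle

variable {m : ℕ} {u : ℕ → V} {h : ℕ → K} {x : V}

theorem insert_between (hC : RainbowCycle G m u h) (hm : 2 ≤ m) (hx : ∀ t, t < m → u t ≠ x) {z : K}
    (hz : ∀ t, t < m → h t ≠ z) (h₀ : (G z).Adj x (u 0))
    (h₁ : (G (h (m - 1))).Adj x (u (m - 1))) : ∃ w e, RainbowCycle G (m + 1) w e := by
  refine (hC.toPath.cons hx (fun t ht => hz t (by omega)) (fun _ => h₀)).close (i := m - 1)
    (α := h (m - 1)) (β := h (m - 2)) (by omega) ?_ ?_ ?_ ?_ ?_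
  · intro e
    have := hC.cinj _ _ (by omega) (by omega) e
    omega
  · intro t ht htm e
    split_ifs at e
    · exact hz _ (by omega) e.symm
    · have := hC.cinj _ _ (by omega) (by omega) e
      omega
  · intro t ht htm e
    split_ifs at e
    · exact hz _ (by omega) e.symm
    · have := hC.cinj _ _ (by omega) (by omega) e
      omega
  · simpa using h₁
  · have := (hC.adj (m - 2) (by omega)).symm
    rw [show m - 2 + 1 = m - 1 by omega] at this
    rwa [if_neg (by omega), if_neg (by omega), show m + 1 - 1 - 1 = m - 1 by omega,
      show m - 1 - 1 = m - 2 by omega]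

theorem insert_by_rotation (hC : RainbowCycle G m u h) (hx : ∀ t, t < m → u t ≠ x) {γ α : K}
    (hγα : γ ≠ α) (hγ : ∀ t, t + 1 < m → h t ≠ γ) (hα : ∀ t, t + 1 < m → h t ≠ α)
    (h₀ : (G γ).Adj x (u 0)) {i : ℕ} (hi : i + 1 < m) (h₁ : (G (h i)).Adj (u (m - 1)) (u i))
    (h₂ : (G α).Adj x (u (i + 1))) : ∃ w e, RainbowCycle G (m + 1) w e := by
  refine (hC.toPath.cons hx hγ (fun _ => h₀)).close (i := i + 1)
    (α := α) (β := h i) (by omega) (hα i hi).symm ?_ ?_ ?_ ?_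
  · intro t ht hti e
    split_ifs at e
    · exact hγα e
    · exact hα _ (by omega) e
  · intro t ht hti e
    split_ifs at e
    · exact hγ _ (by omega) e.symm
    · have := hC.cinj _ _ (by omega) (by omega) e
      omega
  · simpa using h₂
  · rw [if_neg (by omega), if_neg (by omega)]
    simpa using h₁

theorem insert_by_exchange (hC : RainbowCycle G m u h) (hx : ∀ t, t < m → u t ≠ x) {z : K}
    (hz : ∀ t, t < m → h t ≠ z) {r i : ℕ} (hr : r + 1 < m) (hi : i + 1 < m) (hir : i ≠ r)
    (h₀ : (G z).Adj x (u r)) (h₁ : (G (h (m - 1))).Adj x (u (r + 1)))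
    (h₂ : (G (h i)).Adj (u (m - 1)) (u i)) (h₃ : (G (h r)).Adj (u 0) (u (i + 1))) :
    ∃ w e, RainbowCycle G (m + 1) w e := by
  have hP : RainbowPath G (m + 1) (fun t => if t ≤ r then u t else if t = r + 1 then x else u (t - 1))
      (fun t => if t < r then h t else if t = r then z else if t = r + 1 then h (m - 1)
        else h (t - 1)) := by
    refine ⟨fun s t hs ht hst => ?_, fun s t hs ht hst => ?_, fun t ht => ?_⟩
    · split_ifs at hst <;> first
        | omega
        | exact absurd hst (hx _ (by omega))
        | exact absurd hst.symm (hx _ (by omega))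
        | (have := hC.inj _ _ (by omega) (by omega) hst; omega)
    · split_ifs at hst <;> first
        | omega
        | exact absurd hst (hz _ (by omega))
        | exact absurd hst.symm (hz _ (by omega))
        | (have := hC.cinj _ _ (by omega) (by omega) hst; omega)
    · rcases lt_trichotomy t r with htr | rfl | htr
      · rw [if_pos htr, if_pos htr.le, if_pos (by omega)]
        exact hC.adj t (by omega)
      · rw [if_neg (lt_irrefl t), if_pos rfl, if_pos le_rfl, if_neg (by omega), if_pos rfl]
        exact h₀.symm
      · rw [if_neg (by omega : ¬t < r), if_neg (by omega : ¬t = r), if_neg (by omega : ¬t ≤ r),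
          if_neg (by omega : ¬t + 1 ≤ r), if_neg (by omega : ¬t + 1 = r + 1), Nat.add_sub_cancel]
        by_cases htr' : t = r + 1
        · subst htr'
          rw [if_pos rfl, if_pos rfl]
          exact h₁
        · rw [if_neg htr', if_neg htr']
          have := hC.adj (t - 1) (by omega)
          rwa [show t - 1 + 1 = t by omega] at this
  refine hP.close (i := if i < r then i else i + 1) (α := h r) (β := h i) ?_ ?_ ?_ ?_ ?_ ?_
  · split_ifs <;> omega
  · intro e
    exact hir (hC.cinj _ _ (by omega) (by omega) e).symm
  · intro t ht hti e
    split_ifs at e hti <;> first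
      | exact hz _ (by omega) e.symm
      | (have := hC.cinj _ _ (by omega) (by omega) e; omega)
  · intro t ht hti e
    split_ifs at e hti <;> first
      | exact hz _ (by omega) e.symm
      | (have := hC.cinj _ _ (by omega) (by omega) e; omega)
  · split_ifs <;> first
      | omega
      | simpa using h₃
  · split_ifs <;> first
      | omega
      | simpa using h₂

end RainbowCycle

open Classical in
/-- In a rainbow cycle missing exactly one vertex and at least one colour, the remaining vertex can
be included. -/
theorem CyclicRainbow.exists_hamilton [Fintype V] {m d : ℕ} [NeZero m] {v : ZMod m → V}
    {c : ZMod m → K} (h : CyclicRainbow G m v c) (hm : 2 ≤ m) {x : V} {z : K} (hx : ∀ i, v i ≠ x)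
    (hz : ∀ i, c i ≠ z) (hV : Fintype.card V = m + 1) (hd : m + 1 ≤ 2 * d)
    (hdeg : ∀ a y, d ≤ (Finset.univ.filter fun w => (G a).Adj y w).card) :
    ∃ w e, RainbowCycle G (m + 1) w e := by
  by_contra hno
  have huniv : (Finset.univ : Finset V) = insert x (Finset.univ.image v) := by
    symm
    rw [← Finset.card_eq_iff_eq_univ, Finset.card_insert_of_notMem (by simpa using hx),
      Finset.card_image_of_injective _ h.inj, hV, Finset.card_univ, ZMod.card]
  have hsurj : ∀ w, w ≠ x → ∃ i, v i = w := by
    intro w hw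
    have : w ∈ insert x (Finset.univ.image v) := huniv ▸ Finset.mem_univ w
    simpa [hw] using this
  set I : V → Finset (ZMod m) := fun u => Finset.univ.filter fun i => (G (c i)).Adj (v i) u with hI
  set N : ZMod m → K → V → Finset (ZMod m) :=
    fun s a y => Finset.univ.filter fun i => (G a).Adj y (v (i + s)) with hN
  have hN₁ : ∀ s a y, d ≤ (N s a y).card + 1 := by
    intro s a y
    refine (hdeg a y).trans ((Finset.card_le_card (t := insert x ((N s a y).image
      fun i => v (i + s))) ?_).trans ((Finset.card_insert_le _ _).trans
        (Nat.add_le_add_right Finset.card_image_le 1)))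
    intro w hw
    by_cases hwx : w = x
    · simp [hwx]
    · obtain ⟨i, rfl⟩ := hsurj w hwx
      refine Finset.mem_insert_of_mem (Finset.mem_image.2 ⟨i - s, ?_, by simp⟩)
      simpa [hN] using hw
  have hN₀ : ∀ s a, d ≤ (N s a x).card := by
    intro s a
    refine (hdeg a x).trans ((Finset.card_le_card (t := (N s a x).image
      fun i => v (i + s)) ?_).trans Finset.card_image_le)
    intro w hw
    have hw' : (G a).Adj x w := by simpa using hw
    obtain ⟨i, rfl⟩ := hsurj w hw'.ne'
    refine Finset.mem_image.2 ⟨i - s, ?_, by simp⟩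
    simpa [hN] using hw'
  have hsum : m * d ≤ (I x).card + ∑ k, (I (v k)).card := by
    have h₁ : ∑ u, (I u).card = (I x).card + ∑ k, (I (v k)).card := by
      rw [huniv, Finset.sum_insert (by simpa using hx), Finset.sum_image h.inj.injOn]
    have h₂ : ∑ u, (I u).card = ∑ i, (Finset.univ.filter fun w => (G (c i)).Adj (v i) w).card := by
      simp only [hI, Finset.card_filter]
      exact Finset.sum_comm
    rw [← h₁, h₂]
    calc m * d = ∑ _i : ZMod m, d := by simp [ZMod.card]
      _ ≤ _ := Finset.sum_le_sum fun i _ => hdeg _ _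
  have hcast : ((m - 1 : ℕ) : ZMod m) = -1 := by
    rw [Nat.cast_sub (by omega)]
    simp
  have hidx : ∀ k i : ZMod m, i ≠ k → ∃ t : ℕ, t + 1 < m ∧ i = k + 1 + t := by
    intro k i hik
    have hlt := (i - k - 1).val_lt
    refine ⟨(i - k - 1).val, ?_, by rw [ZMod.natCast_zmod_val]; ring⟩
    by_contra hcon
    apply hik
    have : (i - k - 1).val = m - 1 := by omega
    have h' := congrArg (Nat.cast : ℕ → ZMod m) this
    rw [ZMod.natCast_zmod_val, hcast] at h'
    linear_combination h'
  have hlast : ∀ k : ZMod m, k + 1 + ((m - 1 : ℕ) : ZMod m) = k := by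
    intro k
    rw [hcast]
    ring
  have hinter : ∀ s t : Finset (ZMod m), m < s.card + t.card → ∃ i, i ∈ s ∧ i ∈ t := by
    intro s t hst
    obtain ⟨i, hi⟩ := Finset.inter_nonempty_of_card_lt_card_add_card (Finset.subset_univ s)
      (Finset.subset_univ t) (by rwa [Finset.card_univ, ZMod.card])
    exact ⟨i, Finset.mem_inter.1 hi⟩
  have hrot : ∀ (k : ZMod m) (γ α : K), γ ≠ α → (∀ i, i ≠ k → c i ≠ γ) → (∀ i, i ≠ k → c i ≠ α) →
      k ∈ N 1 γ x → (I (v k)).card + (N 1 α x).card ≤ m := by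
    intro k γ α hγα hγ hα hk
    by_contra hcon
    obtain ⟨i, hi₁, hi₂⟩ := hinter _ _ (not_le.1 hcon)
    simp only [hI, hN, Finset.mem_filter, Finset.mem_univ, true_and] at hi₁ hi₂ hk
    have hik : i ≠ k := by
      rintro rfl
      exact (G _).irrefl hi₁
    have hne : ∀ t : ℕ, t + 1 < m → k + 1 + (t : ZMod m) ≠ k := by
      intro t ht e
      have := (h.rotate (k + 1)).inj t (m - 1) (by omega) (by omega) (by rw [hlast, e])
      omega
    obtain ⟨t, ht, rfl⟩ := hidx k i hik
    refine hno ((h.rotate (k + 1)).insert_by_rotation (x := x) (γ := γ) (α := α) (i := t)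
      (fun _ _ => hx _) hγα (fun t ht => hγ _ (hne t ht)) (fun t ht => hα _ (hne t ht))
      (by simpa using hk) ht ?_ ?_)
    · rw [hlast]
      exact hi₁.symm
    · rwa [Nat.cast_succ, ← add_assoc]
  have hzc : ∀ k i, i ≠ k → c i ≠ c k := fun k i hik e => hik (h.cinj e)
  have hIx : (I x).card + d ≤ m := by
    by_contra hcon
    obtain ⟨i, hi₁, hi₂⟩ := hinter (I x) (N 1 z x) (by have := hN₀ 1 z; omega)
    simp only [hI, hN, Finset.mem_filter, Finset.mem_univ, true_and] at hi₁ hi₂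
    refine hno ((h.rotate (i + 1)).insert_between hm (x := x) (fun _ _ => hx _) (z := z)
      (fun _ _ => hz _) (by simpa using hi₂) ?_)
    rw [hlast]
    exact hi₁.symm
  have hIN : ∀ k, k ∈ N 1 z x → (I (v k)).card + d ≤ m := by
    intro k hk
    have := hrot k z (c k) (hz k).symm (fun i _ => hz i) (hzc k) hk
    have := hN₀ 1 (c k)
    omega
  obtain ⟨k, hk⟩ : ∃ k, m + 2 ≤ (I (v k)).card + d := by
    by_contra! hcon
    have h₁ : ∑ k, ((I (v k)).card + d + if k ∈ N 1 z x then 1 else 0) ≤ ∑ _k : ZMod m, (m + 1) := by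
      refine Finset.sum_le_sum fun k _ => ?_
      have := hcon k
      split_ifs with hkN
      · have := hIN k hkN
        omega
      · omega
    rw [Finset.sum_add_distrib, Finset.sum_add_distrib, Finset.sum_boole] at h₁
    simp only [Finset.sum_const, Finset.card_univ, ZMod.card, smul_eq_mul, Nat.cast_id,
      Finset.filter_univ_mem] at h₁
    have h₂ := hN₀ 1 z
    have h₃ := Nat.mul_le_mul_left m hd
    have h₄ : m * (2 * d) = m * d + m * d := by ring
    omega
  have hkN : k ∉ N 1 z x := fun hk' => by
    have := hIN k hk'
    omega
  have hkc : k ∉ N 1 (c k) x := fun hk' => by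
    have := hrot k (c k) z (hz k) (hzc k) (fun i _ => hz i) hk'
    have := hN₀ 1 z
    omega
  obtain ⟨j, hj₁, hj₂⟩ := hinter (N 0 z x) (N 1 (c k) x) (by
    have := hN₀ 0 z
    have := hN₀ 1 (c k)
    omega)
  have hjk : j ≠ k := by
    rintro rfl
    exact hkc hj₂
  have hkI : k ∉ I (v k) := by simp [hI]
  have hkN' : k ∉ N 1 (c j) (v (k + 1)) := by simp [hN]
  obtain ⟨i, hi⟩ := Finset.inter_nonempty_of_card_lt_card_add_card
    (s := (Finset.univ.erase k).erase j) (t := (I (v k)).erase j)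
    (u := (N 1 (c j) (v (k + 1))).erase j)
    (fun i hi => by
      rw [Finset.mem_erase] at hi
      simp only [Finset.mem_erase, Finset.mem_univ, and_true]
      exact ⟨hi.1, fun e => hkI (e ▸ hi.2)⟩)
    (fun i hi => by
      rw [Finset.mem_erase] at hi
      simp only [Finset.mem_erase, Finset.mem_univ, and_true]
      exact ⟨hi.1, fun e => hkN' (e ▸ hi.2)⟩)
    (by
      rw [Finset.card_erase_of_mem (by simp [hjk]), Finset.card_erase_of_mem (Finset.mem_univ k),
        Finset.card_univ, ZMod.card]
      have h₁ := Finset.pred_card_le_card_erase (s := I (v k)) (a := j)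
      have h₂ := Finset.pred_card_le_card_erase (s := N 1 (c j) (v (k + 1))) (a := j)
      have h₃ := hN₁ 1 (c j) (v (k + 1))
      omega)
  simp only [Finset.mem_inter, Finset.mem_erase] at hi
  obtain ⟨⟨hij, hi₁⟩, -, hi₂⟩ := hi
  have hik : i ≠ k := fun e => hkI (e ▸ hi₁)
  simp only [hI, hN, Finset.mem_filter, Finset.mem_univ, true_and, add_zero] at hi₁ hi₂ hj₁ hj₂
  obtain ⟨r, hr, rfl⟩ := hidx k j hjk
  obtain ⟨t, ht, rfl⟩ := hidx k i hik
  refine hno ((h.rotate (k + 1)).insert_by_exchange (x := x) (fun _ _ => hx _) (z := z)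
    (fun _ _ => hz _) hr ht (fun e => hij (by rw [e])) hj₁ ?_ ?_ ?_)
  · rwa [hlast, Nat.cast_succ, ← add_assoc]
  · rw [hlast]
    exact hi₁.symm
  · rw [Nat.cast_zero, add_zero, Nat.cast_succ, ← add_assoc]
    exact hi₂

theorem exists_forall_ne_of_lt_card {α : Type*} [Fintype α] {m : ℕ} (f : ℕ → α)
    (hm : m < Fintype.card α) : ∃ x, ∀ t, t < m → f t ≠ x := by
  classical
  have hlt : ((Finset.range m).image f).card < Fintype.card α :=
    Finset.card_image_le.trans_lt (by simpa using hm)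
  obtain ⟨x, hx⟩ := Finset.exists_mem_notMem_of_card_lt_card (t := Finset.univ)
    (s := (Finset.range m).image f) (by simpa using hlt)
  refine ⟨x, fun t ht e => hx.2 (Finset.mem_image.2 ⟨t, Finset.mem_range.2 ht, e⟩)⟩

open Classical in
/-- A spanning rainbow path missing at least one colour yields a spanning rainbow cycle. -/
theorem RainbowPath.exists_hamilton [Fintype V] [Fintype K] {m d : ℕ} {v : ℕ → V} {c : ℕ → K}
    (h : RainbowPath G (m + 1) v c) (hm : 2 ≤ m) (hV : Fintype.card V = m + 1)
    (hK : Fintype.card K = m + 1) (hd : m + 1 ≤ 2 * d)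
    (hdeg : ∀ a y, d ≤ (Finset.univ.filter fun w => (G a).Adj y w).card) :
    ∃ w e, RainbowCycle G (m + 1) w e := by
  by_contra hno
  obtain ⟨z, hz⟩ := exists_forall_ne_of_lt_card (m := m) c (by omega)
  have hsurj : ∀ w, ∃ t, t < m + 1 ∧ v t = w := by
    intro w
    have : (Finset.range (m + 1)).image v = Finset.univ := by
      rw [← Finset.card_eq_iff_eq_univ, Finset.card_image_of_injOn, Finset.card_range, hV]
      intro s hs t ht
      exact h.inj s t (by simpa using hs) (by simpa using ht)
    have hw : w ∈ (Finset.range (m + 1)).image v := this ▸ Finset.mem_univ w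
    simpa using hw
  have hends : ¬(G z).Adj (v m) (v 0) := by
    intro hadj
    have hlast := (h.adj (m - 1) (by omega)).symm
    rw [show m - 1 + 1 = m by omega] at hlast
    refine hno (h.close (i := m - 1) (by omega) (α := z) (β := c (m - 1)) ?_ ?_ ?_ ?_ ?_)
    · exact (hz _ (by omega)).symm
    · exact fun t ht _ => hz t (by omega)
    · exact fun t ht hti e => hti (h.cinj _ _ ht (by omega) e)
    · rw [show m - 1 + 1 = m by omega]
      exact hadj.symm
    · exact hlast
  set A := (Finset.range (m - 1)).filter fun i => (G (c 0)).Adj (v 1) (v (i + 2)) with hA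
  set B := (Finset.range (m - 1)).filter fun i => (G z).Adj (v m) (v (i + 1)) with hB
  have hAcard : d ≤ A.card + 1 := by
    refine (hdeg (c 0) (v 1)).trans ((Finset.card_le_card (t := insert (v 0) (A.image
      fun i => v (i + 2))) ?_).trans ((Finset.card_insert_le _ _).trans
        (Nat.add_le_add_right Finset.card_image_le 1)))
    intro w hw
    have hw' : (G (c 0)).Adj (v 1) w := by simpa using hw
    obtain ⟨t, ht, rfl⟩ := hsurj w
    rcases t with _ | _ | t
    · simp
    · exact absurd hw' (G _).irrefl
    · refine Finset.mem_insert_of_mem (Finset.mem_image.2 ⟨t, ?_, rfl⟩)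
      rw [hA, Finset.mem_filter, Finset.mem_range]
      exact ⟨by omega, hw'⟩
  have hBcard : d ≤ B.card := by
    refine (hdeg z (v m)).trans ((Finset.card_le_card (t := B.image
      fun i => v (i + 1)) ?_).trans Finset.card_image_le)
    intro w hw
    have hw' : (G z).Adj (v m) w := by simpa using hw
    obtain ⟨t, ht, rfl⟩ := hsurj w
    rcases t with _ | t
    · exact absurd hw' hends
    · have htm : t + 1 ≠ m := by
        rintro rfl
        exact (G _).irrefl hw'
      refine Finset.mem_image.2 ⟨t, ?_, rfl⟩
      rw [hB, Finset.mem_filter, Finset.mem_range]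
      exact ⟨by omega, hw'⟩
  obtain ⟨i, hi⟩ := Finset.inter_nonempty_of_card_lt_card_add_card (t := A) (u := B)
    (Finset.filter_subset _ _) (Finset.filter_subset _ _)
    (by rw [Finset.card_range]; omega)
  simp only [hA, hB, Finset.mem_inter, Finset.mem_filter, Finset.mem_range] at hi
  obtain ⟨⟨hi, hi₁⟩, -, hi₂⟩ := hi
  obtain ⟨w, e, hC⟩ := h.tail.close (i := i) (by omega) (α := c 0) (β := z) (hz _ (by omega))
    (fun t ht _ e => absurd (h.cinj _ _ (by omega) (by omega) e) (by omega))
    (fun t ht _ => hz _ (by omega)) hi₁ (by rwa [show m - 1 + 1 = m by omega])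
  have : NeZero m := ⟨by omega⟩
  obtain ⟨x, hx⟩ := exists_forall_ne_of_lt_card (m := m) w (by omega)
  obtain ⟨z', hz'⟩ := exists_forall_ne_of_lt_card (m := m) e (by omega)
  exact hno (hC.toCyclic.exists_hamilton hm (fun i => hx _ i.val_lt) (fun i => hz' _ i.val_lt)
    hV hd hdeg)

open Classical in
theorem exists_rainbowPath [Fintype V] [Fintype K] {d : ℕ}
    (hVK : Fintype.card V = Fintype.card K) (hd : Fintype.card V ≤ 2 * d)
    (hdeg : ∀ a y, d ≤ (Finset.univ.filter fun w => (G a).Adj y w).card) (ℓ : ℕ) (hℓ : 1 ≤ ℓ)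
    (hℓV : ℓ ≤ Fintype.card V) : ∃ v c, RainbowPath G ℓ v c := by
  induction ℓ, hℓ using Nat.le_induction with
  | base =>
    obtain ⟨x⟩ : Nonempty V := Fintype.card_pos_iff.1 (by omega)
    obtain ⟨z⟩ : Nonempty K := Fintype.card_pos_iff.1 (by omega)
    exact ⟨fun _ => x, fun _ => z, fun s t hs ht _ => by omega, fun s t hs ht _ => by omega,
      fun t ht => by omega⟩
  | succ ℓ hℓ ih =>
    obtain ⟨v, c, h⟩ := ih (by omega)
    by_contra hno
    have hmax : ∀ v c, RainbowPath G ℓ v c → ∀ z, (∀ t, t + 1 < ℓ → c t ≠ z) →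
        d ≤ ((Finset.range (ℓ - 1)).filter fun i => (G z).Adj (v 0) (v (i + 1))).card := by
      intro v c h z hz
      refine (hdeg z (v 0)).trans ((Finset.card_le_card (t := Finset.image (fun i => v (i + 1)) _)
        ?_).trans Finset.card_image_le)
      intro w hw
      have hw' : (G z).Adj (v 0) w := by simpa using hw
      obtain ⟨t, ht, rfl⟩ : ∃ t, t < ℓ ∧ v t = w := by
        by_contra! hcon
        exact hno ⟨_, _, h.cons hcon hz fun _ => hw'.symm⟩
      rcases t with _ | t
      · exact absurd hw' (G _).irrefl
      · refine Finset.mem_image.2 ⟨t, ?_, rfl⟩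
        rw [Finset.mem_filter, Finset.mem_range]
        exact ⟨by omega, hw'⟩
    obtain ⟨a, ha⟩ := exists_forall_ne_of_lt_card (m := ℓ - 1) c (by omega)
    obtain ⟨b, hb⟩ := exists_forall_ne_of_lt_card (m := ℓ)
      (fun t => if t + 1 < ℓ then c t else a) (by omega)
    have hab : a ≠ b := by simpa [Nat.sub_add_cancel hℓ] using hb (ℓ - 1) (by omega)
    have hb' : ∀ t, t + 1 < ℓ → c t ≠ b := fun t ht => by simpa [ht] using hb t (by omega)
    have ha' : ∀ t, t + 1 < ℓ → c t ≠ a := fun t ht => ha t (by omega)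
    have hA := hmax v c h a ha'
    have hB := hmax _ _ h.reverse b (fun t ht => hb' _ (by omega))
    have hB' : d ≤ ((Finset.range (ℓ - 1)).filter
        fun i => (G b).Adj (v (ℓ - 1)) (v i)).card := by
      refine hB.trans (Finset.card_le_card_of_injOn (fun i => ℓ - 1 - (i + 1)) ?_ ?_)
      · intro i hi
        simp only [Finset.coe_filter, Finset.mem_range, Set.mem_ofPred_eq] at hi ⊢
        exact ⟨by omega, hi.2⟩
      · intro i hi j hj hij
        simp only [Finset.coe_filter, Finset.mem_range, Set.mem_ofPred_eq] at hi hj hij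
        omega
    obtain ⟨i, hi⟩ := Finset.inter_nonempty_of_card_lt_card_add_card
      (Finset.filter_subset _ _) (Finset.filter_subset _ _)
      (lt_of_lt_of_le (by rw [Finset.card_range]; omega) (add_le_add hA hB'))
    simp only [Finset.mem_inter, Finset.mem_filter, Finset.mem_range] at hi
    obtain ⟨⟨hi, hi₁⟩, -, hi₂⟩ := hi
    obtain ⟨w, e, hC⟩ := h.close (i := i) (by omega) hab (fun t ht _ => ha' t ht)
      (fun t ht _ => hb' t ht) hi₁ hi₂
    obtain ⟨x, hx⟩ := exists_forall_ne_of_lt_card (m := ℓ) w (by omega)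
    obtain ⟨z, hz⟩ := exists_forall_ne_of_lt_card (m := ℓ) e (by omega)
    have hdℓ : d ≤ ℓ - 1 := hA.trans ((Finset.card_filter_le _ _).trans (by simp))
    obtain ⟨j, hj, hxj⟩ : ∃ j, j < ℓ ∧ (G z).Adj x (w j) := by
      by_contra! hcon
      have hcard : ((Finset.range ℓ).image w).card = ℓ := by
        rw [Finset.card_image_of_injOn, Finset.card_range]
        intro s hs t ht
        exact hC.inj s t (by simpa using hs) (by simpa using ht)
      have hsub : (Finset.univ.filter fun y => (G z).Adj x y) ⊆
          (insert x ((Finset.range ℓ).image w))ᶜ := by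
        intro y hy
        have hy' : (G z).Adj x y := by simpa using hy
        simp only [Finset.mem_compl, Finset.mem_insert, Finset.mem_image, Finset.mem_range]
        rintro (rfl | ⟨t, ht, rfl⟩)
        · exact (G _).irrefl hy'
        · exact hcon t ht hy'
      have h₁ := (hdeg z x).trans (Finset.card_le_card hsub)
      rw [Finset.card_compl, Finset.card_insert_of_notMem, hcard] at h₁
      · omega
      · simpa using hx
    have : NeZero ℓ := ⟨by omega⟩
    refine hno ⟨_, _, (hC.toCyclic.rotate (j : ZMod ℓ)).toPath.cons (x := x) (z := z)
      (fun t _ => hx _ (ZMod.val_lt _)) (fun t _ => hz _ (ZMod.val_lt _)) fun _ => ?_⟩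
    rwa [Nat.cast_zero, add_zero, ZMod.val_natCast, Nat.mod_eq_of_lt hj]

end

/-- **Transversal Dirac theorem** (Joos–Kim, here for large `n`).
There is `n0` such that for every `n ≥ n0`, every collection `G 1, …, G n` of graphs on a
common vertex set of size `n`, each with minimum degree at least `n/2`, contains a
transversal Hamilton cycle: a cyclic ordering `σ` of the vertices together with a
bijection `φ` assigning a distinct colour to each edge of the cycle such that every
edge lies in the graph of its colour. -/
theorem transversal_dirac :
    ∃ n0 : ℕ, ∀ n : ℕ, n0 ≤ n →
      ∀ G : Fin n → SimpleGraph (Fin n),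
        (∀ i v, (n : ℝ) / 2 ≤ degS (G i) v) →
        ∃ σ φ : Fin n ≃ Fin n, ∀ k : Fin n, (G (φ k)).Adj (σ k) (σ (finRotate n k)) := by
  classical
  refine ⟨3, fun n hn G hG => ?_⟩
  obtain ⟨m, rfl⟩ : ∃ m, n = m + 1 := ⟨n - 1, by omega⟩
  have hdeg : ∀ a y, (m + 2) / 2 ≤ (Finset.univ.filter fun w => (G a).Adj y w).card := by
    intro a y
    have h := hG a y
    rw [degS, Nat.card_eq_fintype_card, Fintype.card_subtype, div_le_iff₀ two_pos] at h
    have h' : m + 1 ≤ (Finset.univ.filter fun w => (G a).Adj y w).card * 2 := by exact_mod_cast h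
    omega
  obtain ⟨v, c, hP⟩ := exists_rainbowPath (G := G) rfl (by rw [Fintype.card_fin]; omega) hdeg
    (m + 1) (by omega) (by rw [Fintype.card_fin])
  obtain ⟨w, e, hC⟩ := hP.exists_hamilton (by omega) (Fintype.card_fin _) (Fintype.card_fin _)
    (by omega) hdeg
  have hw : Function.Injective fun k : Fin (m + 1) => w k := fun i j hij =>
    Fin.ext (hC.inj _ _ i.2 j.2 hij)
  have he : Function.Injective fun k : Fin (m + 1) => e k := fun i j hij =>
    Fin.ext (hC.cinj _ _ i.2 j.2 hij)
  refine ⟨Equiv.ofBijective _ (Finite.injective_iff_bijective.1 hw),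
    Equiv.ofBijective _ (Finite.injective_iff_bijective.1 he), fun k => ?_⟩
  simp only [Equiv.ofBijective_apply]
  rcases Nat.lt_or_ge k.val m with hk | hk
  · rw [coe_finRotate_of_ne_last (Fin.ne_of_lt hk)]
    exact hC.adj _ (by omega)
  · obtain rfl : k = Fin.last m := Fin.ext (by have := k.2; simp only [Fin.val_last]; omega)
    rw [finRotate_last]
    exact hC.last
end

section
/- Let 0 < 1/n ≪ d ≪ μ ≪ α ≪ γ, ε ≪ δ ≪ 1. Suppose 𝒢 = {G_1, …, G_n} is a collection of bipartite graphs on a common vertex partition V = V_1 ∪ V_2 with |V_1| = |V_2| = n such that: (i) 𝒢 is (γ, α, ε, δ)-stable; (ii) for every i ∈ [n], d_{G_i}(x) ≥ (1/2 − μ)n for all but at most dn vertices x ∈ V; and (iii) for every x ∈ V, d_{G_i}(x) ≥ (1/2 − μ)n for all but at most dn colors i ∈ [n]. Then 𝒢 contains a transversal perfect matching. -/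
open Finset
open scoped Classical symmDiff

noncomputable def dRin {n : ℕ} (G : Fin n → Fin n → Prop) (v : Fin n)
    (S : Finset (Fin n)) : ℕ :=
  Nat.card {w : Fin n // w ∈ S ∧ G v w}

noncomputable def dLin {n : ℕ} (G : Fin n → Fin n → Prop) (w : Fin n)
    (S : Finset (Fin n)) : ℕ :=
  Nat.card {v : Fin n // v ∈ S ∧ G v w}

/-- `e_G(A, B)`: number of edges between `A ⊆ V₁` and `B ⊆ V₂`. -/
noncomputable def eBip {n : ℕ} (G : Fin n → Fin n → Prop)
    (A B : Finset (Fin n)) : ℕ :=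
  Nat.card {p : Fin n × Fin n // p.1 ∈ A ∧ p.2 ∈ B ∧ G p.1 p.2}

/-- A balanced bipartite graph `G` is `μ`-nice if `e_G(A,B) ≥ μn²` whenever `A ⊆ V₁`,
`B ⊆ V₂` have size at least `(1/2 − μ)n`. -/
def isNice {n : ℕ} (μ : ℝ) (G : Fin n → Fin n → Prop) : Prop :=
  ∀ A B : Finset (Fin n), (1/2 - μ) * (n : ℝ) ≤ A.card → (1/2 - μ) * (n : ℝ) ≤ B.card →
    μ * (n : ℝ) ^ 2 ≤ (eBip G A B : ℝ)

/-- `G` is `ε`-extremal if it is not `ε⁵`-nice. -/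
def isExtremal {n : ℕ} (ε : ℝ) (G : Fin n → Fin n → Prop) : Prop :=
  ¬ isNice (ε ^ 5) G

/-- `(A1, B1, C1, A2, B2, C2)` is a characteristic partition of the `ε`-extremal
balanced bipartite graph `G`. -/
def isCharPart {n : ℕ} (ε : ℝ) (G : Fin n → Fin n → Prop)
    (A1 B1 C1 A2 B2 C2 : Finset (Fin n)) : Prop :=
  (A1 ∪ B1 ∪ C1 = univ ∧ A1.card + B1.card + C1.card = n) ∧
  (A2 ∪ B2 ∪ C2 = univ ∧ A2.card + B2.card + C2.card = n) ∧
  (A1.card : ℝ) = (1/2 - ε) * n ∧ (B1.card : ℝ) = (1/2 - ε) * n ∧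
  (C1.card : ℝ) = 2 * ε * n ∧
  (A2.card : ℝ) = (1/2 - ε) * n ∧ (B2.card : ℝ) = (1/2 - ε) * n ∧
  (C2.card : ℝ) = 2 * ε * n ∧
  (∀ v ∈ A2, (1/2 - 2*ε) * (n : ℝ) ≤ dLin G v A1) ∧
  (∀ v ∈ B2, (1/2 - 2*ε) * (n : ℝ) ≤ dLin G v B1) ∧
  (∀ v ∈ A1, (1/2 - 2*ε) * (n : ℝ) ≤ dRin G v A2) ∧
  (∀ v ∈ B1, (1/2 - 2*ε) * (n : ℝ) ≤ dRin G v B2) ∧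
  ((eBip G A1 B2 : ℝ) ≤ ε * (n : ℝ) ^ 2 ∨ (eBip G B1 A2 : ℝ) ≤ ε * (n : ℝ) ^ 2)


noncomputable def dR {n : ℕ} (G : Fin n → Fin n → Prop) (v : Fin n) : ℕ :=
  Nat.card {w : Fin n // G v w}

noncomputable def dL {n : ℕ} (G : Fin n → Fin n → Prop) (w : Fin n) : ℕ :=
  Nat.card {v : Fin n // G v w}


/-- Either any two members of a family of sets of density about `1/2` are linked through large
intersections in at most two steps, or almost all members are close to one fixed set of density
about `1/2` or to its complement. -/
lemma family_dichotomy {V Ω : Type*} [Fintype V] [Fintype Ω] [DecidableEq Ω]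
    (L : V → Finset Ω) (μ β : ℝ)
    (hL : ∀ z, (1/2 - μ) * (Fintype.card Ω : ℝ) ≤ (L z).card) :
    (∀ x x', β * (Fintype.card Ω : ℝ) ≤ (L x ∩ L x').card ∨
      β * (Fintype.card V : ℝ) ≤ (univ.filter fun z => β * (Fintype.card Ω : ℝ) ≤ (L x ∩ L z).card ∧
        β * (Fintype.card Ω : ℝ) ≤ (L z ∩ L x').card).card) ∨
    ∃ x, ((L x).card : ℝ) ≤ (1/2 + μ + β) * Fintype.card Ω ∧
      ((univ.filter fun z => ¬ (((L z ∆ L x).card : ℝ) ≤ (4 * μ + 4 * β) * Fintype.card Ω ∨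
        ((L z ∆ (L x)ᶜ).card : ℝ) ≤ (4 * μ + 4 * β) * Fintype.card Ω)).card : ℝ)
        ≤ β * Fintype.card V := by
  have hcompl : ∀ x y, ((L x ∩ L y).card : ℝ) < β * Fintype.card Ω →
      ((L y ∆ (L x)ᶜ).card : ℝ) ≤ (2 * μ + 2 * β) * Fintype.card Ω := by
    intro x y h
    have h1 : (L y ∆ (L x)ᶜ) = (L y ∪ L x)ᶜ ∪ (L x ∩ L y) := by
      ext t; simp only [mem_symmDiff, mem_compl, mem_union, mem_inter]; tauto
    have h2 : (L y ∆ (L x)ᶜ).card ≤ (L y ∪ L x)ᶜ.card + (L x ∩ L y).card := by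
      rw [h1]; exact card_union_le _ _
    have h3 := card_union_add_card_inter (L y) (L x)
    have h4 : (L y ∪ L x)ᶜ.card + (L y ∪ L x).card = Fintype.card Ω := by
      rw [add_comm]; exact card_add_card_compl _
    rw [inter_comm] at h3
    have hx := hL x
    have hy := hL y
    rify at h2 h3 h4
    linarith
  by_contra hcon
  push Not at hcon
  obtain ⟨⟨x, x', h1, h2⟩, h3⟩ := hcon
  have hx : ((L x).card : ℝ) ≤ (1/2 + μ + β) * Fintype.card Ω := by
    have h4 := card_union_add_card_inter (L x) (L x')
    have h5 : (L x ∪ L x').card ≤ Fintype.card Ω := card_le_univ _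
    have := hL x'
    rify at h4 h5
    linarith
  have h4 := h3 x hx
  refine absurd (h4.trans_le ?_) (not_lt.2 h2.le)
  norm_cast
  apply card_le_card
  intro z hz
  simp only [mem_filter, mem_univ, true_and] at hz ⊢
  have hΩ : (0 : ℝ) ≤ Fintype.card Ω := by positivity
  constructor
  · by_contra h5
    have h6 := hcompl x z (not_le.1 h5)
    nlinarith [hz.2]
  · by_contra h5
    have h6 := hcompl x' z (by rw [inter_comm]; exact not_le.1 h5)
    have h7 := hcompl x x' h1
    have h8 : L z ∆ L x ⊆ (L z ∆ (L x')ᶜ) ∪ (L x' ∆ (L x)ᶜ) := by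
      intro t; simp only [mem_symmDiff, mem_compl, mem_union]; tauto
    have h9 : (L z ∆ L x).card ≤ (L z ∆ (L x')ᶜ).card + (L x' ∆ (L x)ᶜ).card :=
      (card_le_card h8).trans (card_union_le _ _)
    rify at h9
    linarith [hz.1]

/-- The number of triples with a prescribed `k`-th coordinate, counted through updates. -/
lemma card_update_eq {n : ℕ} (k : Fin 3) (z : Fin n) (P : (Fin 3 → Fin n) → Prop)
    [DecidablePred P] :
    (univ.filter fun t => P (Function.update t k z)).card
      = n * (univ.filter fun t : Fin 3 → Fin n => t k = z ∧ P t).card := by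
  suffices h : (univ.filter fun t => P (Function.update t k z)).card
      = ((univ : Finset (Fin n)) ×ˢ
        (univ.filter fun t : Fin 3 → Fin n => t k = z ∧ P t)).card by
    rw [h, card_product, card_univ, Fintype.card_fin]
  refine card_bij' (fun t _ => (t k, Function.update t k z))
    (fun p _ => Function.update p.2 k p.1) ?_ ?_ ?_ ?_
  · intro t ht; simpa using ht
  · rintro ⟨y, t⟩ ht
    simp only [mem_product, mem_univ, mem_filter, true_and] at ht ⊢
    rw [Function.update_idem, ← ht.1, Function.update_eq_self]; exact ht.2
  · intro t _; simp
  · rintro ⟨y, t⟩ ht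
    simp only [mem_product, mem_univ, mem_filter, true_and] at ht
    simp [← ht.1]

lemma mul_card_eq_sum_update {n : ℕ} (k : Fin 3) (P : (Fin 3 → Fin n) → Prop)
    [DecidablePred P] :
    n * (univ.filter P).card
      = ∑ z, (univ.filter fun t => P (Function.update t k z)).card := by
  simp_rw [card_update_eq, ← mul_sum]
  congr 1
  rw [card_eq_sum_card_fiberwise (f := fun t => t k) (t := univ) (by simp)]
  refine sum_congr rfl fun z _ => ?_
  congr 1; ext t; simp [and_comm]

/-- The layer of `H` at value `z` of the `k`-th coordinate. -/
noncomputable def layer {n : ℕ} (H : (Fin 3 → Fin n) → Prop) (k : Fin 3) (z : Fin n) :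
    Finset (Fin 3 → Fin n) :=
  univ.filter fun t => H (Function.update t k z)

/-- Any two values of the `k`-th coordinate are linked through common slices in at most
two steps. -/
def linked {n : ℕ} (H : (Fin 3 → Fin n) → Prop) (k : Fin 3) (β : ℝ) : Prop :=
  ∀ x x', β * (n : ℝ) ^ 3 ≤ (layer H k x ∩ layer H k x').card ∨
    β * (n : ℝ) ≤ (univ.filter fun z => β * (n : ℝ) ^ 3 ≤ (layer H k x ∩ layer H k z).card ∧
        β * (n : ℝ) ^ 3 ≤ (layer H k z ∩ layer H k x').card).card

/-- If the `k`-th coordinate is not linked, then `H` is close to being determined by a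
two-colouring of the `k`-th coordinate and one of its slices. -/
lemma linked_or_split {n : ℕ} (hn : 0 < n) (H : (Fin 3 → Fin n) → Prop) (k : Fin 3) (μ β : ℝ)
    (hμ : 0 ≤ μ) (hμβ : μ ≤ β)
    (hL : ∀ z, (1/2 - μ) * (n : ℝ) ^ 3 ≤ (layer H k z).card) :
    linked H k β ∨ ∃ (X : Fin n → Prop) (x : Fin n),
      ((univ.filter fun t => ¬ (H t ↔ Xor (X (t k)) (H (Function.update t k x)))).card : ℝ)
        ≤ 9 * β * (n : ℝ) ^ 3 ∧
      ((univ.filter H).card : ℝ) ≤ (1/2 + 11 * β) * (n : ℝ) ^ 3 := by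
  have hβ := hμ.trans hμβ
  have hcard : (Fintype.card (Fin 3 → Fin n) : ℝ) = (n : ℝ) ^ 3 := by simp
  have hn' : (0 : ℝ) < n := by exact_mod_cast hn
  have hd := family_dichotomy (layer H k) μ β (by rw [hcard]; exact hL)
  rw [hcard, Fintype.card_fin] at hd
  refine hd.imp (fun h => h) ?_
  rintro ⟨x, hx, hbad⟩
  obtain ⟨X, hX⟩ : ∃ X : Fin n → Prop, ∀ z, X z ↔ ¬ (((layer H k z ∆ layer H k x).card : ℝ)
    ≤ (4 * μ + 4 * β) * (n : ℝ) ^ 3) := ⟨_, fun _ => Iff.rfl⟩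
  set bad : Fin n → Prop := fun z => ¬ (((layer H k z ∆ layer H k x).card : ℝ)
      ≤ (4 * μ + 4 * β) * (n : ℝ) ^ 3 ∨
    ((layer H k z ∆ (layer H k x)ᶜ).card : ℝ) ≤ (4 * μ + 4 * β) * (n : ℝ) ^ 3) with hbad'
  have hn3 : (0 : ℝ) < (n : ℝ) ^ 3 := by positivity
  have hle : ∀ s : Finset (Fin 3 → Fin n), (s.card : ℝ) ≤ (n : ℝ) ^ 3 := by
    intro s; rw [← hcard]; exact_mod_cast card_le_univ s
  have hsum : ∀ (f : Fin n → ℝ) (c : ℝ), (∀ z, ¬ bad z → f z ≤ c) → 0 ≤ c →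
      (∀ z, f z ≤ (n : ℝ) ^ 3) → ∑ z, f z ≤ n * (c + β * (n : ℝ) ^ 3) := by
    intro f c h1 h0 h2
    calc ∑ z, f z ≤ ∑ z, (c + if bad z then (n : ℝ) ^ 3 else 0) := by
          refine sum_le_sum fun z _ => ?_
          split_ifs with hz
          · linarith [h2 z]
          · linarith [h1 z hz]
      _ = n * c + (univ.filter bad).card * (n : ℝ) ^ 3 := by
          rw [sum_add_distrib, ← sum_filter]; simp
      _ ≤ _ := by nlinarith
  refine ⟨X, x, ?_, ?_⟩
  · have h1 := mul_card_eq_sum_update k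
      (fun t : Fin 3 → Fin n => ¬ (H t ↔ Xor (X (t k)) (H (Function.update t k x))))
    rify at h1
    have h2 := hsum (fun z => ((univ.filter fun t : Fin 3 → Fin n =>
      ¬ (H (Function.update t k z) ↔ Xor (X (Function.update t k z k))
        (H (Function.update (Function.update t k z) k x)))).card : ℝ))
      ((4 * μ + 4 * β) * (n : ℝ) ^ 3) ?_ (by positivity) (fun z => hle _)
    · have h3 : (n : ℝ) * ((univ.filter fun t => ¬ (H t ↔ Xor (X (t k))
          (H (Function.update t k x)))).card : ℝ) ≤ n * (9 * β * (n : ℝ) ^ 3) := by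
        rw [h1]; refine h2.trans ?_
        gcongr
        nlinarith
      exact le_of_mul_le_mul_left h3 hn'
    · intro z hz
      simp only [Function.update_self, Function.update_idem]
      by_cases hXz : X z
      · have : ((layer H k z ∆ (layer H k x)ᶜ).card : ℝ) ≤ (4 * μ + 4 * β) * (n : ℝ) ^ 3 := by
          simp only [hbad', not_not] at hz
          exact hz.resolve_left ((hX z).1 hXz)
        refine le_trans ?_ this
        norm_cast
        apply card_le_card
        intro t
        simp only [mem_filter, mem_univ, true_and, layer, mem_symmDiff, mem_compl, Xor, hXz]
        tauto
      · have : ((layer H k z ∆ layer H k x).card : ℝ) ≤ (4 * μ + 4 * β) * (n : ℝ) ^ 3 := by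
          simpa [hX] using hXz
        refine le_trans ?_ this
        norm_cast
        apply card_le_card
        intro t
        simp only [mem_filter, mem_univ, true_and, layer, mem_symmDiff, Xor, hXz]
        tauto
  · have h1 := mul_card_eq_sum_update k H
    rify at h1
    have h2 := hsum (fun z => ((univ.filter fun t : Fin 3 → Fin n =>
      H (Function.update t k z)).card : ℝ))
      ((1/2 + μ + β + (4 * μ + 4 * β)) * (n : ℝ) ^ 3) ?_ (by positivity) (fun z => hle _)
    · have h3 : (n : ℝ) * ((univ.filter H).card : ℝ) ≤ n * ((1/2 + 11 * β) * (n : ℝ) ^ 3) := by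
        rw [h1]; refine h2.trans ?_
        gcongr
        nlinarith
      exact le_of_mul_le_mul_left h3 hn'
    · intro z hz
      simp only [hbad', not_not] at hz
      change ((layer H k z).card : ℝ) ≤ _
      have key : ∀ S : Finset (Fin 3 → Fin n), (layer H k z).card ≤
          (layer H k z ∆ S).card + S.card := by
        intro S
        refine (card_le_card ?_).trans (card_union_le _ _)
        intro t; simp only [mem_union, mem_symmDiff]; tauto
      rcases hz with hz | hz
      · have := key (layer H k x)
        rify at this
        linarith
      · have := key (layer H k x)ᶜ
        have h5 : (layer H k x)ᶜ.card + (layer H k x).card = Fintype.card (Fin 3 → Fin n) := by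
          rw [add_comm]; exact card_add_card_compl _
        have h6 := hL x
        rify at this h5
        rw [hcard] at h5
        nlinarith

/-- If `H` splits along two coordinates, then it is close to a parity pattern. -/
lemma parity_of_split_split {n : ℕ} (hn : 0 < n) (H : (Fin 3 → Fin n) → Prop) {k l m : Fin 3}
    (hkl : k ≠ l) (hkm : k ≠ m) (hlm : l ≠ m) (θ : ℝ) (X Y : Fin n → Prop) (x y : Fin n)
    (hX : ((univ.filter fun t => ¬ (H t ↔ Xor (X (t k)) (H (Function.update t k x)))).card : ℝ)
      ≤ θ * (n : ℝ) ^ 3)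
    (hY : ((univ.filter fun t => ¬ (H t ↔ Xor (Y (t l)) (H (Function.update t l y)))).card : ℝ)
      ≤ θ * (n : ℝ) ^ 3) :
    ∃ Z : Fin n → Prop, ((univ.filter fun t =>
      ¬ (H t ↔ Xor (X (t k)) (Xor (Y (t l)) (Z (t m))))).card : ℝ) ≤ 3 * θ * (n : ℝ) ^ 3 := by
  have hn' : (0 : ℝ) < n := by exact_mod_cast hn
  have hcover : ∀ j : Fin 3, j = k ∨ j = l ∨ j = m := by
    have : ∀ k l m : Fin 3, k ≠ l → k ≠ m → l ≠ m → ∀ j, j = k ∨ j = l ∨ j = m := by decide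
    exact this k l m hkl hkm hlm
  set B1 : (Fin 3 → Fin n) → Prop := fun t => ¬ (H t ↔ Xor (X (t k)) (H (Function.update t k x)))
    with hB1
  set B2 : (Fin 3 → Fin n) → Prop := fun t => ¬ (H t ↔ Xor (Y (t l)) (H (Function.update t l y)))
    with hB2
  have h12 : ((univ.filter fun t => B1 t ∨ B2 t).card : ℝ) ≤ 2 * θ * (n : ℝ) ^ 3 := by
    have : (univ.filter fun t => B1 t ∨ B2 t).card
        ≤ (univ.filter B1).card + (univ.filter B2).card := by
      rw [filter_or]; exact card_union_le _ _
    rify at this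
    linarith
  obtain ⟨a, ha⟩ : ∃ a, ((univ.filter fun t => B1 (Function.update t k a) ∨
      B2 (Function.update t k a)).card : ℝ) ≤ 2 * θ * (n : ℝ) ^ 3 := by
    by_contra! hcon
    have h1 := mul_card_eq_sum_update k (fun t => B1 t ∨ B2 t)
    rify at h1
    have h2 : ∑ z : Fin n, 2 * θ * (n : ℝ) ^ 3 < ∑ z : Fin n, ((univ.filter fun t =>
        B1 (Function.update t k z) ∨ B2 (Function.update t k z)).card : ℝ) :=
      sum_lt_sum_of_nonempty ⟨⟨0, hn⟩, mem_univ _⟩ fun z _ => hcon z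
    rw [← h1, sum_const, card_univ, Fintype.card_fin, nsmul_eq_mul] at h2
    have := lt_of_mul_lt_mul_left h2 hn'.le
    linarith
  obtain ⟨Z, hZ⟩ : ∃ Z : Fin n → Prop, ∀ c, Z c ↔ Xor (X a)
    (H (Function.update (Function.update (fun _ => c) k a) l y)) := ⟨_, fun _ => Iff.rfl⟩
  refine ⟨Z, ?_⟩
  have hsub : (univ.filter fun t => ¬ (H t ↔ Xor (X (t k)) (Xor (Y (t l)) (Z (t m))))) ⊆
      (univ.filter B1) ∪ (univ.filter fun t => B1 (Function.update t k a) ∨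
        B2 (Function.update t k a)) := by
    intro t
    simp only [mem_filter, mem_univ, true_and, mem_union]
    contrapose!
    rintro ⟨h1, h2, h3⟩
    have e1 : Function.update (Function.update (fun _ => t m) k a) l y
        = Function.update (Function.update t k a) l y := by
      funext j
      rcases hcover j with rfl | rfl | rfl <;> simp [hkl, hkm.symm, hlm.symm]
    simp only [hB1, hB2, not_not, Function.update_self, Function.update_idem,
      Function.update_of_ne hkl.symm] at h1 h2 h3
    rw [hZ, e1, h1]
    have aux : ∀ A B C D E : Prop, (Xor A B ↔ Xor C D) →
        (Xor E B ↔ Xor E (Xor C (Xor A D))) := by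
      intro A B C D E
      by_cases A <;> by_cases B <;> by_cases C <;> by_cases D <;> by_cases E <;> simp_all [Xor]
    exact aux _ _ _ _ _ (h2.symm.trans h3)
  have h4 := (card_le_card hsub).trans (card_union_le _ _)
  rify at h4
  have h5 : ((univ.filter B1).card : ℝ) ≤ θ * (n : ℝ) ^ 3 := hX
  linarith

/-- Either two coordinates are linked, or `H` has density at most about `1/2` and is close to
a parity pattern. -/
lemma linked_pair_or_parity {n : ℕ} (hn : 0 < n) (H : (Fin 3 → Fin n) → Prop) (μ β : ℝ)
    (hμ : 0 ≤ μ) (hμβ : μ ≤ β)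
    (hL : ∀ k z, (1/2 - μ) * (n : ℝ) ^ 3 ≤ (layer H k z).card) :
    (∃ k l m : Fin 3, k ≠ l ∧ k ≠ m ∧ l ≠ m ∧ linked H k β ∧ linked H l β) ∨
    ∃ x y z : Fin n → Prop, ((univ.filter fun t =>
        ¬ (H t ↔ Xor (x (t 0)) (Xor (y (t 1)) (z (t 2))))).card : ℝ) ≤ 27 * β * (n : ℝ) ^ 3 ∧
      ((univ.filter H).card : ℝ) ≤ (1/2 + 11 * β) * (n : ℝ) ^ 3 := by
  have h := fun k => linked_or_split hn H k μ β hμ hμβ (hL k)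
  rcases h 0 with h0 | ⟨X, x, h0, hH⟩
  · rcases h 1 with h1 | ⟨Y, y, h1, hH⟩
    · exact Or.inl ⟨0, 1, 2, by decide, by decide, by decide, h0, h1⟩
    rcases h 2 with h2 | ⟨Z, z, h2, -⟩
    · exact Or.inl ⟨0, 2, 1, by decide, by decide, by decide, h0, h2⟩
    obtain ⟨X, hX⟩ := parity_of_split_split hn H (k := 1) (l := 2) (m := 0) (by decide) (by decide)
      (by decide) _ Y Z y z h1 h2
    refine Or.inr ⟨X, Y, Z, ?_, hH⟩
    rw [show 27 * β = 3 * (9 * β) by ring]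
    refine le_trans ?_ hX
    norm_cast
    refine card_le_card fun t => ?_
    simp only [mem_filter, mem_univ, true_and]
    unfold Xor; tauto
  · rcases h 1 with h1 | ⟨Y, y, h1, -⟩
    · rcases h 2 with h2 | ⟨Z, z, h2, -⟩
      · exact Or.inl ⟨1, 2, 0, by decide, by decide, by decide, h1, h2⟩
      obtain ⟨Y, hY⟩ := parity_of_split_split hn H (k := 0) (l := 2) (m := 1) (by decide)
        (by decide) (by decide) _ X Z x z h0 h2
      refine Or.inr ⟨X, Y, Z, ?_, hH⟩
      rw [show 27 * β = 3 * (9 * β) by ring]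
      refine le_trans ?_ hY
      norm_cast
      refine card_le_card fun t => ?_
      simp only [mem_filter, mem_univ, true_and]
      unfold Xor; tauto
    · obtain ⟨Z, hZ⟩ := parity_of_split_split hn H (k := 0) (l := 1) (m := 2) (by decide)
        (by decide) (by decide) _ X Y x y h0 h1
      refine Or.inr ⟨X, Y, Z, ?_, hH⟩
      rw [show 27 * β = 3 * (9 * β) by ring]
      exact hZ

/-- The `3`-partite `3`-graph of a collection of bipartite graphs: a vertex of each side and
a colour. -/
def colorGraph {n : ℕ} (G : Fin n → Fin n → Fin n → Prop) (t : Fin 3 → Fin n) : Prop :=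
  G (t 2) (t 0) (t 1)

/-- Almost all graphs of the collection are extremal with respect to a common pair of sets. -/
def commonExtremal {n : ℕ} (η : ℝ) (G : Fin n → Fin n → Fin n → Prop) : Prop :=
  ∃ X₁ X₂ : Finset (Fin n),
    ((1/2 - η) * (n : ℝ) ≤ X₁.card ∧ (X₁.card : ℝ) ≤ (1/2 + η) * n) ∧
    ((1/2 - η) * (n : ℝ) ≤ X₂.card ∧ (X₂.card : ℝ) ≤ (1/2 + η) * n) ∧
    ((univ.filter fun c => ¬ ((eBip (G c) X₁ X₂ : ℝ) ≤ η * (n : ℝ) ^ 2 ∨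
      (eBip (G c) X₁ X₂ᶜ : ℝ) ≤ η * (n : ℝ) ^ 2)).card : ℝ) ≤ η * n

lemma card_filter_apply {n : ℕ} (k : Fin 3) (p : Fin n → Prop) :
    (univ.filter fun t : Fin 3 → Fin n => p (t k)).card = n ^ 2 * (univ.filter p).card := by
  have : (univ.filter fun t : Fin 3 → Fin n => p (t k))
      = Fintype.piFinset fun i => if i = k then univ.filter p else univ := by
    ext t
    simp only [mem_filter, mem_univ, true_and, Fintype.mem_piFinset]
    constructor
    · intro h i
      split_ifs with hi
      · subst hi; simpa using h
      · simp
    · intro h; simpa using h k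
  have h : ∀ i, (if i = k then univ.filter p else univ : Finset (Fin n)).card
      = if i = k then (univ.filter p).card else n := by
    intro i; split_ifs <;> simp
  simp only [this, Fintype.card_piFinset, Fin.prod_univ_three, h]
  obtain rfl | rfl | rfl : k = 0 ∨ k = 1 ∨ k = 2 := by fin_cases k <;> simp
  · rw [if_pos rfl, if_neg (by decide), if_neg (by decide)]; ring
  · rw [if_neg (by decide), if_pos rfl, if_neg (by decide)]; ring
  · rw [if_neg (by decide), if_neg (by decide), if_pos rfl]; ring

lemma dR_eq {n : ℕ} (G : Fin n → Fin n → Prop) (v : Fin n) :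
    dR G v = (univ.filter fun w => G v w).card := by
  rw [dR, Nat.card_eq_fintype_card, Fintype.card_subtype]

lemma dL_eq {n : ℕ} (G : Fin n → Fin n → Prop) (w : Fin n) :
    dL G w = (univ.filter fun v => G v w).card := by
  rw [dL, Nat.card_eq_fintype_card, Fintype.card_subtype]

lemma eBip_eq {n : ℕ} (G : Fin n → Fin n → Prop) (A B : Finset (Fin n)) :
    eBip G A B = (univ.filter fun p : Fin n × Fin n => p.1 ∈ A ∧ p.2 ∈ B ∧ G p.1 p.2).card := by
  rw [eBip, Nat.card_eq_fintype_card, Fintype.card_subtype]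

lemma mul_eBip {n : ℕ} (G : Fin n → Fin n → Prop) (A B : Finset (Fin n)) :
    n * eBip G A B
      = (univ.filter fun t : Fin 3 → Fin n => t 0 ∈ A ∧ t 1 ∈ B ∧ G (t 0) (t 1)).card := by
  rw [eBip_eq]
  suffices h : ((univ : Finset (Fin n)) ×ˢ
      (univ.filter fun p : Fin n × Fin n => p.1 ∈ A ∧ p.2 ∈ B ∧ G p.1 p.2)).card
      = (univ.filter fun t : Fin 3 → Fin n => t 0 ∈ A ∧ t 1 ∈ B ∧ G (t 0) (t 1)).card by
    rw [← h, card_product, card_univ, Fintype.card_fin]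
  refine card_bij' (fun q _ => ![q.2.1, q.2.2, q.1]) (fun t _ => (t 2, t 0, t 1)) ?_ ?_ ?_ ?_
  · rintro ⟨z, a, b⟩ h; simpa using h
  · intro t h; simpa using h
  · rintro ⟨z, a, b⟩ h; simp
  · intro t h; ext i; fin_cases i <;> simp

lemma card_layer_zero {n : ℕ} (hn : 0 < n) (G : Fin n → Fin n → Fin n → Prop) (v : Fin n) :
    (layer (colorGraph G) 0 v).card = n * ∑ c, dR (G c) v := by
  apply Nat.eq_of_mul_eq_mul_left hn
  rw [layer, mul_card_eq_sum_update 2, mul_sum, mul_sum]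
  refine sum_congr rfl fun c _ => ?_
  rw [dR_eq, ← mul_assoc, ← sq, ← card_filter_apply 1]
  congr 1

lemma card_layer_one {n : ℕ} (hn : 0 < n) (G : Fin n → Fin n → Fin n → Prop) (w : Fin n) :
    (layer (colorGraph G) 1 w).card = n * ∑ c, dL (G c) w := by
  apply Nat.eq_of_mul_eq_mul_left hn
  rw [layer, mul_card_eq_sum_update 2, mul_sum, mul_sum]
  refine sum_congr rfl fun c _ => ?_
  rw [dL_eq, ← mul_assoc, ← sq, ← card_filter_apply 0]
  congr 1

lemma card_layer_two {n : ℕ} (hn : 0 < n) (G : Fin n → Fin n → Fin n → Prop) (c : Fin n) :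
    (layer (colorGraph G) 2 c).card = n * ∑ v, dR (G c) v := by
  apply Nat.eq_of_mul_eq_mul_left hn
  rw [layer, mul_card_eq_sum_update 0, mul_sum, mul_sum]
  refine sum_congr rfl fun v _ => ?_
  rw [dR_eq, ← mul_assoc, ← sq, ← card_filter_apply 1]
  congr 1

lemma sum_lower_bound {n : ℕ} (f : Fin n → ℕ) (μ d : ℝ) (hμ : 0 ≤ μ) (hμ2 : μ ≤ 1/2) (hdμ : d ≤ μ)
    (h : ((univ.filter fun i => (f i : ℝ) < (1/2 - μ) * n).card : ℝ) ≤ d * n) :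
    (1/2 - 2 * μ) * (n : ℝ) ^ 3 ≤ ((n * ∑ i, f i : ℕ) : ℝ) := by
  have h1 : ∑ i : Fin n, ((1/2 - μ) * (n : ℝ) -
      if (f i : ℝ) < (1/2 - μ) * n then (1/2 - μ) * (n : ℝ) else 0) ≤ ∑ i, (f i : ℝ) := by
    refine sum_le_sum fun i _ => ?_
    split_ifs with hi
    · simp
    · linarith
  rw [sum_sub_distrib, ← sum_filter, sum_const, sum_const, card_univ, Fintype.card_fin,
    nsmul_eq_mul, nsmul_eq_mul] at h1
  push_cast
  have hn : (0 : ℝ) ≤ n := by positivity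
  have h2 : (1/2 - 2 * μ) * (n : ℝ) ^ 2 ≤ ∑ i, (f i : ℝ) := by
    refine le_trans ?_ h1
    have h3 : ((univ.filter fun i => (f i : ℝ) < (1/2 - μ) * n).card : ℝ) * ((1/2 - μ) * n)
        ≤ μ * n * ((1/2 - μ) * n) := by
      refine mul_le_mul_of_nonneg_right (h.trans (by gcongr)) ?_
      have : 0 ≤ 1/2 - μ := by linarith
      positivity
    nlinarith [sq_nonneg (μ * (n : ℝ)), sq_nonneg (n : ℝ), mul_nonneg hμ (sq_nonneg (n : ℝ))]
  calc (1/2 - 2 * μ) * (n : ℝ) ^ 3 = n * ((1/2 - 2 * μ) * (n : ℝ) ^ 2) := by ring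
    _ ≤ _ := by gcongr

/-- In a parity pattern of density about `1/2` with large pair degrees in direction `m`, the
two-colouring of the `m`-th coordinate is balanced. -/
lemma parity_balanced {n : ℕ} (hn : 0 < n) (H : (Fin 3 → Fin n) → Prop) (m : Fin 3) (β : ℝ)
    (hβ : β ≤ 1/100) (y : Fin n → Prop) (W : (Fin 3 → Fin n) → Prop)
    (hW : ∀ t b, W (Function.update t m b) ↔ W t)
    (hy : ((univ.filter fun t => ¬ (H t ↔ Xor (y (t m)) (W t))).card : ℝ)
      ≤ 27 * β * (n : ℝ) ^ 3)
    (hH : ((univ.filter H).card : ℝ) ≤ (1/2 + 11 * β) * (n : ℝ) ^ 3)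
    (hdeg : ((univ.filter fun t => ((univ.filter fun b => H (Function.update t m b)).card : ℝ)
      < (1/2 - β) * n).card : ℝ) ≤ β * (n : ℝ) ^ 3) :
    (1/2 - 79 * β) * (n : ℝ) ≤ (univ.filter y).card ∧
      ((univ.filter y).card : ℝ) ≤ (1/2 + 79 * β) * n := by
  have hn' : (0 : ℝ) < n := by exact_mod_cast hn
  have hswap : ∀ (P : (Fin 3 → Fin n) → Prop) [DecidablePred P],
      ∑ t, ((univ.filter fun b => P (Function.update t m b)).card : ℝ)
        = n * ((univ.filter P).card : ℝ) := by
    intro P _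
    have h := mul_card_eq_sum_update m P
    simp only [card_filter] at h ⊢
    rw [sum_comm] at h
    exact_mod_cast h.symm
  obtain ⟨t, ht⟩ : ∃ t : Fin 3 → Fin n,
      ((univ.filter fun b => H (Function.update t m b)).card : ℝ) +
      ((univ.filter fun b => ¬ (H (Function.update t m b) ↔
        Xor (y (Function.update t m b m)) (W (Function.update t m b)))).card : ℝ) +
      (if ((univ.filter fun b => H (Function.update t m b)).card : ℝ)
        < (1/2 - β) * n then (n : ℝ) else 0) ≤ (1/2 + 39 * β) * n := by
    by_contra hcon
    simp only [not_exists, not_le] at hcon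
    have h1 := sum_lt_sum_of_nonempty (s := (univ : Finset (Fin 3 → Fin n)))
      ⟨fun _ => ⟨0, hn⟩, mem_univ _⟩ fun t _ => hcon t
    rw [sum_add_distrib, sum_add_distrib, hswap H, hswap
      (fun t => ¬ (H t ↔ Xor (y (t m)) (W t))), ← sum_filter, sum_const, sum_const, card_univ,
      nsmul_eq_mul, nsmul_eq_mul] at h1
    have hc : (Fintype.card (Fin 3 → Fin n) : ℝ) = (n : ℝ) ^ 3 := by simp
    rw [hc] at h1
    nlinarith
  simp only [Function.update_self, hW] at ht
  split_ifs at ht with hbad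
  · have h1 : (0 : ℝ) ≤ (univ.filter fun b => H (Function.update t m b)).card := by positivity
    have h2 : (0 : ℝ) ≤ (univ.filter fun b => ¬ (H (Function.update t m b) ↔
        Xor (y b) (W t))).card := by positivity
    nlinarith
  have h1 : (univ.filter fun b => H (Function.update t m b)).card ≤
      (univ.filter fun b => Xor (y b) (W t)).card +
      (univ.filter fun b => ¬ (H (Function.update t m b) ↔ Xor (y b) (W t))).card := by
    refine (card_le_card ?_).trans (card_union_le _ _)
    intro b; simp only [mem_union, mem_filter, mem_univ, true_and]; tauto
  have h2 : (univ.filter fun b => Xor (y b) (W t)).card ≤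
      (univ.filter fun b => H (Function.update t m b)).card +
      (univ.filter fun b => ¬ (H (Function.update t m b) ↔ Xor (y b) (W t))).card := by
    refine (card_le_card ?_).trans (card_union_le _ _)
    intro b; simp only [mem_union, mem_filter, mem_univ, true_and]; tauto
  have h3 : (univ.filter y).card + (univ.filter fun b => ¬ y b).card = n := by
    have := card_filter_add_card_filter_not (s := (univ : Finset (Fin n))) y
    rwa [card_univ, Fintype.card_fin] at this
  have h0 : (0 : ℝ) ≤ (univ.filter fun b => ¬ (H (Function.update t m b) ↔
        Xor (y b) (W t))).card := by positivity
  by_cases hWt : W t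
  · have h4 : (univ.filter fun b => Xor (y b) (W t)).card = (univ.filter fun b => ¬ y b).card := by
      congr 1; ext b; simp [Xor, hWt]
    rw [h4] at h1 h2
    rify at h1 h2 h3
    constructor <;> nlinarith
  · have h4 : (univ.filter fun b => Xor (y b) (W t)).card = (univ.filter y).card := by
      congr 1; ext b; simp [Xor, hWt]
    rw [h4] at h1 h2
    rify at h1 h2
    constructor <;> nlinarith

/-- A parity pattern of density about `1/2` makes the collection commonly extremal. -/
lemma commonExtremal_of_parity {n : ℕ} (hn : 0 < n) (G : Fin n → Fin n → Fin n → Prop) (η β : ℝ)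
    (hβ : β ≤ 1/100) (hη : 0 < η) (hβη : 79 * β ≤ η) (hβη2 : 27 * β ≤ η ^ 2)
    (x y z : Fin n → Prop)
    (hxyz : ((univ.filter fun t => ¬ (colorGraph G t ↔
      Xor (x (t 0)) (Xor (y (t 1)) (z (t 2))))).card : ℝ) ≤ 27 * β * (n : ℝ) ^ 3)
    (hH : ((univ.filter (colorGraph G)).card : ℝ) ≤ (1/2 + 11 * β) * (n : ℝ) ^ 3)
    (hR : ∀ c, ((univ.filter fun v => (dR (G c) v : ℝ) < (1/2 - β) * n).card : ℝ) ≤ β * n)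
    (hL : ∀ c, ((univ.filter fun v => (dL (G c) v : ℝ) < (1/2 - β) * n).card : ℝ) ≤ β * n) :
    commonExtremal η G := by
  have hn' : (0 : ℝ) < n := by exact_mod_cast hn
  have hdeg : ∀ (k : Fin 3) (hk : k ≠ 2) (f : Fin n → Fin n → ℕ),
      (∀ c, ((univ.filter fun v => (f c v : ℝ) < (1/2 - β) * n).card : ℝ) ≤ β * n) →
      ((univ.filter fun t : Fin 3 → Fin n => (f (t 2) (t k) : ℝ) < (1/2 - β) * n).card : ℝ)
        ≤ β * (n : ℝ) ^ 3 := by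
    intro k hk f hf
    have h := mul_card_eq_sum_update 2
      (fun t : Fin 3 → Fin n => (f (t 2) (t k) : ℝ) < (1/2 - β) * n)
    simp only [Function.update_self, Function.update_of_ne hk] at h
    have h2 : ∀ c, (univ.filter fun t : Fin 3 → Fin n => (f c (t k) : ℝ) < (1/2 - β) * n).card
        = n ^ 2 * (univ.filter fun v => (f c v : ℝ) < (1/2 - β) * n).card := by
      intro c
      have := card_filter_apply k (fun v => (f c v : ℝ) < (1/2 - β) * n)
      convert this using 2
    simp only [h2] at h
    rify at h
    refine le_of_mul_le_mul_left (a := (n : ℝ)) ?_ hn'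
    rw [h, ← mul_sum]
    have h3 : ∑ c : Fin n, ((univ.filter fun v => (f c v : ℝ) < (1/2 - β) * n).card : ℝ)
        ≤ ∑ c : Fin n, β * n := sum_le_sum fun c _ => hf c
    rw [sum_const, card_univ, Fintype.card_fin, nsmul_eq_mul] at h3
    calc (n : ℝ) ^ 2 * _ ≤ (n : ℝ) ^ 2 * (n * (β * n)) := by gcongr
      _ = _ := by ring
  refine ⟨univ.filter x, univ.filter y, ?_, ?_, ?_⟩
  · have h := parity_balanced hn (colorGraph G) 0 β hβ x
      (fun t => Xor (y (t 1)) (z (t 2))) (by intro t b; simp) (by convert hxyz) hH (by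
        have := hdeg 1 (by decide) (fun c v => dL (G c) v) hL
        simp only [dL_eq] at this
        convert this using 8; simp [colorGraph])
    exact ⟨by nlinarith [h.1], by nlinarith [h.2]⟩
  · have h := parity_balanced hn (colorGraph G) 1 β hβ y
      (fun t => Xor (x (t 0)) (z (t 2))) (by intro t b; simp) (by
        refine le_trans ?_ hxyz
        norm_cast
        refine card_le_card fun t => ?_
        simp only [mem_filter, mem_univ, true_and]
        unfold Xor; tauto) hH (by
        have := hdeg 0 (by decide) (fun c v => dR (G c) v) hR
        simp only [dR_eq] at this
        convert this using 8; simp [colorGraph])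
    exact ⟨by nlinarith [h.1], by nlinarith [h.2]⟩
  · set bad : (Fin 3 → Fin n) → Prop := fun t => ¬ (colorGraph G t ↔
      Xor (x (t 0)) (Xor (y (t 1)) (z (t 2)))) with hbad
    set E := univ.filter fun c => ¬ ((eBip (G c) (univ.filter x) (univ.filter y) : ℝ)
      ≤ η * (n : ℝ) ^ 2 ∨ (eBip (G c) (univ.filter x) (univ.filter y)ᶜ : ℝ) ≤ η * (n : ℝ) ^ 2)
      with hE
    have h1 := mul_card_eq_sum_update 2 bad
    rify at h1
    have h2 : ∀ c ∈ E, η * (n : ℝ) ^ 3 ≤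
        ((univ.filter fun t => bad (Function.update t 2 c)).card : ℝ) := by
      intro c hc
      simp only [hE, mem_filter, mem_univ, true_and, not_or, not_le] at hc
      have h3 : ∃ S : Finset (Fin n), η * (n : ℝ) ^ 2 < eBip (G c) (univ.filter x) S ∧
          ∀ b ∈ S, y b ↔ ¬ z c := by
        by_cases hz : z c
        · exact ⟨_, hc.2, by intro b; simp [hz]⟩
        · exact ⟨_, hc.1, by intro b; simp [hz]⟩
      obtain ⟨S, hS, hb⟩ := h3
      have h4 := mul_eBip (G c) (univ.filter x) S
      have h5 : (univ.filter fun t : Fin 3 → Fin n => t 0 ∈ univ.filter x ∧ t 1 ∈ S ∧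
          G c (t 0) (t 1)).card ≤ (univ.filter fun t => bad (Function.update t 2 c)).card := by
        refine card_le_card fun t => ?_
        simp only [mem_filter, mem_univ, true_and, hbad, colorGraph]
        rintro ⟨hx, hy, hG⟩
        have := hb _ hy
        simp [hx, hG, this, Xor]
      rw [← h4] at h5
      rify at h5
      refine le_trans ?_ h5
      calc η * (n : ℝ) ^ 3 = n * (η * (n : ℝ) ^ 2) := by ring
        _ ≤ _ := by gcongr
    have h3 : (E.card : ℝ) * (η * (n : ℝ) ^ 3) ≤ n * (27 * β * (n : ℝ) ^ 3) := by
      rw [← nsmul_eq_mul, ← sum_const]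
      calc ∑ _c ∈ E, η * (n : ℝ) ^ 3
          ≤ ∑ c ∈ E, ((univ.filter fun t => bad (Function.update t 2 c)).card : ℝ) :=
            sum_le_sum h2
        _ ≤ ∑ c, ((univ.filter fun t => bad (Function.update t 2 c)).card : ℝ) :=
            sum_le_sum_of_subset_of_nonneg (subset_univ _) fun _ _ _ => by positivity
        _ = _ := h1.symm
        _ ≤ _ := by gcongr
    have h4 : n * (27 * β * (n : ℝ) ^ 3) ≤ η * n * (η * (n : ℝ) ^ 3) := by
      have : (27 * β) * (n : ℝ) ^ 4 ≤ η ^ 2 * (n : ℝ) ^ 4 := by gcongr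
      linarith
    exact le_of_mul_le_mul_right (h3.trans h4) (by positivity)

/-- The quadruple `q` of triples, preceded by the triple `t`. -/
def extend {n : ℕ} (t : Fin 3 → Fin n) (q : Fin 4 → Fin 3 → Fin n) : Fin 5 → Fin 3 → Fin n :=
  Fin.cons t q

/-- The quadruple `q` of edges is disjoint from `t`, and the vertices of `t` and `q` together
can be partitioned into five edges. -/
def IsAbsorber {n : ℕ} (H : (Fin 3 → Fin n) → Prop) (t : Fin 3 → Fin n)
    (q : Fin 4 → Fin 3 → Fin n) : Prop :=
  (∀ j, Function.Injective fun i => extend t q i j) ∧ (∀ i, H (q i)) ∧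
    ∃ σ : Fin 3 → Equiv.Perm (Fin 5), ∀ s, H fun j => extend t q (σ j s) j

/-- The edges `e` and `e'` can be rearranged to cover `x` instead of the `k`-th vertex
of `e'`. -/
def Swaps {n : ℕ} (H : (Fin 3 → Fin n) → Prop) (k : Fin 3) (x : Fin n)
    (e e' : Fin 3 → Fin n) : Prop :=
  H e ∧ H e' ∧ (H (Function.update e' k x) ∨
    H (Function.update e k x) ∧ H (Function.update e' k (e k)))

lemma isAbsorber_of_swaps {n : ℕ} (H : (Fin 3 → Fin n) → Prop) {k l : Fin 3} (hkl : k ≠ l)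
    (t : Fin 3 → Fin n) (q : Fin 4 → Fin 3 → Fin n)
    (hinj : ∀ j, Function.Injective fun i => extend t q i j)
    (hk : Swaps H k (t k) (q 0) (q 1)) (hl : Swaps H l (t l) (q 2) (q 3))
    (ht : H (Function.update (Function.update t k (q 1 k)) l (q 3 l))) : IsAbsorber H t q := by
  have b0 : extend t q 0 = t := rfl
  have b1 : extend t q 1 = q 0 := rfl
  have b2 : extend t q 2 = q 1 := rfl
  have b3 : extend t q 3 = q 2 := rfl
  have b4 : extend t q 4 = q 3 := rfl
  obtain ⟨σ, h0, h3, h4, h12⟩ : ∃ σ : Equiv.Perm (Fin 5), σ 0 = 2 ∧ σ 3 = 3 ∧ σ 4 = 4 ∧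
      H (Function.update (q 0) k (extend t q (σ 1) k)) ∧
      H (Function.update (q 1) k (extend t q (σ 2) k)) := by
    obtain ⟨h0, h1, h | ⟨h, h'⟩⟩ := hk
    · refine ⟨Equiv.swap 0 2, by decide, by decide, by decide, ?_, ?_⟩
      · rw [show (Equiv.swap 0 2 : Equiv.Perm (Fin 5)) 1 = 1 by decide, b1]; simpa
      · rw [show (Equiv.swap 0 2 : Equiv.Perm (Fin 5)) 2 = 0 by decide, b0]; simpa
    · refine ⟨Equiv.swap 0 2 * Equiv.swap 1 2, by decide, by decide, by decide, ?_, ?_⟩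
      · rw [show (Equiv.swap 0 2 * Equiv.swap 1 2 : Equiv.Perm (Fin 5)) 1 = 0 by decide, b0]
        simpa
      · rw [show (Equiv.swap 0 2 * Equiv.swap 1 2 : Equiv.Perm (Fin 5)) 2 = 1 by decide, b1]
        simpa
  obtain ⟨τ, g0, g1, g2, g34⟩ : ∃ σ : Equiv.Perm (Fin 5), σ 0 = 4 ∧ σ 1 = 1 ∧ σ 2 = 2 ∧
      H (Function.update (q 2) l (extend t q (σ 3) l)) ∧
      H (Function.update (q 3) l (extend t q (σ 4) l)) := by
    obtain ⟨h0, h1, h | ⟨h, h'⟩⟩ := hl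
    · refine ⟨Equiv.swap 0 4, by decide, by decide, by decide, ?_, ?_⟩
      · rw [show (Equiv.swap 0 4 : Equiv.Perm (Fin 5)) 3 = 3 by decide, b3]; simpa
      · rw [show (Equiv.swap 0 4 : Equiv.Perm (Fin 5)) 4 = 0 by decide, b0]; simpa
    · refine ⟨Equiv.swap 0 4 * Equiv.swap 3 4, by decide, by decide, by decide, ?_, ?_⟩
      · rw [show (Equiv.swap 0 4 * Equiv.swap 3 4 : Equiv.Perm (Fin 5)) 3 = 0 by decide, b0]
        simpa
      · rw [show (Equiv.swap 0 4 * Equiv.swap 3 4 : Equiv.Perm (Fin 5)) 4 = 3 by decide, b3]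
        simpa
  refine ⟨hinj, fun i => ?_, fun j => if j = k then σ else if j = l then τ else 1, fun s => ?_⟩
  · fin_cases i
    exacts [hk.1, hk.2.1, hl.1, hl.2.1]
  · have key : ∀ r : Fin 3 → Fin n, H r →
        (r k = extend t q (σ s) k) → (r l = extend t q (τ s) l) →
        (∀ j, j ≠ k → j ≠ l → r j = extend t q s j) →
        H fun j => extend t q ((if j = k then σ else if j = l then τ else 1) s) j := by
      intro r hr h1 h2 h3
      convert hr using 1
      funext j
      split_ifs with hj hj'
      · rw [hj, h1]
      · rw [hj', h2]
      · rw [h3 j hj hj']; rfl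
    have hlk := hkl.symm
    obtain rfl | rfl | rfl | rfl | rfl : s = 0 ∨ s = 1 ∨ s = 2 ∨ s = 3 ∨ s = 4 := by
      fin_cases s <;> simp
    · refine key _ ht ?_ ?_ ?_
      · simp [hkl, h0, b2]
      · simp [g0, b4]
      · intro j hj hj'; simp [hj, hj', b0]
    · refine key _ h12.1 (by simp) (by simp [hlk, g1, b1]) ?_
      intro j hj hj'; simp [hj, b1]
    · refine key _ h12.2 (by simp) (by simp [hlk, g2, b2]) ?_
      intro j hj hj'; simp [hj, b2]
    · refine key _ g34.1 (by simp [hkl, h3, b3]) (by simp) ?_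
      intro j hj hj'; simp [hj', b3]
    · refine key _ g34.2 (by simp [hkl, h4, b4]) (by simp) ?_
      intro j hj hj'; simp [hj', b4]

/-- Few quadruples have a given coordinate determined by the others. -/
lemma mul_card_coordinate_eq_le {n : ℕ} (i : Fin 4) (j : Fin 3)
    (g : (Fin 4 → Fin 3 → Fin n) → Fin n)
    (hg : ∀ q z, g (Function.update q i (Function.update (q i) j z)) = g q) :
    n * (univ.filter fun q : Fin 4 → Fin 3 → Fin n => q i j = g q).card ≤ n ^ 12 := by
  have h := card_le_card_of_injOn
    (s := (univ : Finset (Fin n)) ×ˢ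
      (univ.filter fun q : Fin 4 → Fin 3 → Fin n => q i j = g q)) (t := univ)
    (fun p => Function.update p.2 i (Function.update (p.2 i) j p.1)) (by simp) (by
      rintro ⟨z, q⟩ hq ⟨z', q'⟩ hq' h
      simp only [coe_product, coe_univ, Set.mem_prod, coe_filter, mem_univ, true_and,
        Set.mem_ofPred_eq, Set.mem_univ] at hq hq'
      simp only at h
      have hz : z = z' := by simpa using congrFun (congrFun h i) j
      have hgq : g q = g q' := by rw [← hg q z, ← hg q' z', h]
      refine Prod.ext hz ?_
      funext i' j'
      by_cases hi : i' = i
      · subst hi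
        by_cases hj : j' = j
        · subst hj; simp only; rw [hq, hq', hgq]
        · simpa [hj] using congrFun (congrFun h i') j'
      · simpa [hi] using congrFun (congrFun h i') j')
  rw [card_product, card_univ, card_univ, Fintype.card_fin] at h
  refine h.trans (le_of_eq ?_)
  simp [← pow_mul]

/-- Few quadruples are degenerate or meet `t`. -/
lemma mul_card_not_injective_le {n : ℕ} (t : Fin 3 → Fin n) :
    n * (univ.filter fun q : Fin 4 → Fin 3 → Fin n =>
      ¬ ∀ j, Function.Injective fun i => extend t q i j).card ≤ 75 * n ^ 12 := by
  have hsub : (univ.filter fun q : Fin 4 → Fin 3 → Fin n =>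
      ¬ ∀ j, Function.Injective fun i => extend t q i j) ⊆
      (univ : Finset (Fin 5 × Fin 5 × Fin 3)).biUnion fun a => univ.filter fun q =>
        a.1 < a.2.1 ∧ extend t q a.2.1 a.2.2 = extend t q a.1 a.2.2 := by
    intro q hq
    simp only [mem_filter, mem_univ, true_and, not_forall, Function.Injective] at hq
    obtain ⟨j, i, i', h, hne⟩ := hq
    simp only [mem_biUnion, mem_univ, mem_filter, true_and]
    rcases lt_or_gt_of_ne hne with hlt | hlt
    · exact ⟨(i, i', j), hlt, h.symm⟩
    · exact ⟨(i', i, j), hlt, h⟩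
  have h := (card_le_card hsub).trans card_biUnion_le
  calc n * _ ≤ n * _ := Nat.mul_le_mul_left n h
    _ ≤ ∑ _a : Fin 5 × Fin 5 × Fin 3, n ^ 12 := by
      rw [mul_sum]
      refine sum_le_sum fun a _ => ?_
      obtain ⟨i, i', j⟩ := a
      by_cases hlt : i < i'
      · simp only [hlt, true_and]
        obtain ⟨i₀, rfl⟩ : ∃ i₀ : Fin 4, i' = i₀.succ :=
          ⟨i'.pred (by rintro rfl; exact absurd hlt (by simp)), by simp⟩
        refine mul_card_coordinate_eq_le i₀ j (fun q => extend t q i j) fun q z => ?_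
        induction i using Fin.cases with
        | zero => rfl
        | succ i₁ =>
          have : i₁ ≠ i₀ := by rintro rfl; exact lt_irrefl _ hlt
          simp [extend, this]
      · simp [hlt]
    _ = 75 * n ^ 12 := by simp

lemma le_card_swap_step {n : ℕ} (hn : 0 < n) (H : (Fin 3 → Fin n) → Prop) (k : Fin 3) (β : ℝ)
    (x y : Fin n) (h : β * (n : ℝ) ^ 3 ≤ (layer H k x ∩ layer H k y).card) :
    β * (n : ℝ) ^ 2 ≤ (univ.filter fun e : Fin 3 → Fin n =>
      e k = y ∧ H e ∧ H (Function.update e k x)).card := by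
  have h1 := card_update_eq k y (fun e => H e ∧ H (Function.update e k x))
  have h2 : (univ.filter fun e => H (Function.update e k y) ∧
      H (Function.update (Function.update e k y) k x)) = layer H k x ∩ layer H k y := by
    ext e; simp [layer, and_comm]
  rw [h2] at h1
  rw [h1] at h
  have hn' : (0 : ℝ) < n := by exact_mod_cast hn
  push_cast at h
  refine le_of_mul_le_mul_left (a := (n : ℝ)) ?_ hn'
  calc (n : ℝ) * (β * n ^ 2) = β * n ^ 3 := by ring
    _ ≤ _ := h

/-- In a linked direction there are many pairs of edges covering `x` instead of `x'`. -/
lemma le_card_swaps {n : ℕ} (hn : 0 < n) (H : (Fin 3 → Fin n) → Prop) (k : Fin 3) (β : ℝ)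
    (hβ : 0 ≤ β) (hβ' : β ≤ 1/3) (hlink : linked H k β)
    (hL : ∀ z, 1/3 * (n : ℝ) ^ 3 ≤ (layer H k z).card) (x x' : Fin n) :
    β ^ 3 * (n : ℝ) ^ 5 ≤ (univ.filter fun p : (Fin 3 → Fin n) × (Fin 3 → Fin n) =>
      Swaps H k x p.1 p.2 ∧ p.2 k = x').card := by
  have hn' : (0 : ℝ) < n := by exact_mod_cast hn
  rcases hlink x x' with h | h
  · have h1 := le_card_swap_step hn H k β x x' h
    have h2 : 1/3 * (n : ℝ) ^ 3 ≤ (univ.filter H).card := by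
      have h3 := mul_card_eq_sum_update k H
      have h4 : ∑ _z : Fin n, 1/3 * (n : ℝ) ^ 3 ≤ ∑ z, ((layer H k z).card : ℝ) :=
        sum_le_sum fun z _ => hL z
      rw [sum_const, card_univ, Fintype.card_fin, nsmul_eq_mul] at h4
      rify at h3
      refine le_of_mul_le_mul_left (a := (n : ℝ)) ?_ hn'
      rw [h3]
      exact h4
    have h3 : univ.filter H ×ˢ (univ.filter fun e : Fin 3 → Fin n =>
        e k = x' ∧ H e ∧ H (Function.update e k x)) ⊆ univ.filter fun p =>
        Swaps H k x p.1 p.2 ∧ p.2 k = x' := by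
      rintro ⟨e, e'⟩ h
      simp only [mem_product, mem_filter, mem_univ, true_and] at h ⊢
      exact ⟨⟨h.1, h.2.2.1, Or.inl h.2.2.2⟩, h.2.1⟩
    have h4 := card_le_card h3
    rw [card_product] at h4
    rify at h4
    refine le_trans ?_ h4
    have h5 : β ^ 2 ≤ 1/3 := by nlinarith
    calc β ^ 3 * (n : ℝ) ^ 5 ≤ (1/3 * β) * n ^ 5 := by gcongr; nlinarith
      _ = (1/3 * n ^ 3) * (β * n ^ 2) := by ring
      _ ≤ _ := by gcongr
  · set Z := univ.filter fun z => β * (n : ℝ) ^ 3 ≤ (layer H k x ∩ layer H k z).card ∧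
        β * (n : ℝ) ^ 3 ≤ (layer H k z ∩ layer H k x').card with hZ
    have h1 : ∀ z ∈ Z, (β * (n : ℝ) ^ 2) * (β * (n : ℝ) ^ 2) ≤
        ((univ.filter fun p : (Fin 3 → Fin n) × (Fin 3 → Fin n) =>
          Swaps H k x p.1 p.2 ∧ p.2 k = x').filter fun p => p.1 k = z).card := by
      intro z hz
      simp only [hZ, mem_filter, mem_univ, true_and] at hz
      have h2 := le_card_swap_step hn H k β x z hz.1
      have h3 := le_card_swap_step hn H k β z x' hz.2
      have h4 : (univ.filter fun e : Fin 3 → Fin n => e k = z ∧ H e ∧ H (Function.update e k x))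
          ×ˢ (univ.filter fun e : Fin 3 → Fin n => e k = x' ∧ H e ∧ H (Function.update e k z))
          ⊆ (univ.filter fun p : (Fin 3 → Fin n) × (Fin 3 → Fin n) =>
          Swaps H k x p.1 p.2 ∧ p.2 k = x').filter fun p => p.1 k = z := by
        rintro ⟨e, e'⟩ h
        simp only [mem_product, mem_filter, mem_univ, true_and] at h ⊢
        obtain ⟨⟨rfl, a, b⟩, c, d, f⟩ := h
        exact ⟨⟨⟨a, d, Or.inr ⟨b, f⟩⟩, c⟩, rfl⟩
      have h5 := card_le_card h4
      rw [card_product] at h5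
      rify at h5
      refine le_trans ?_ h5
      gcongr
    rw [card_eq_sum_card_fiberwise (f := fun p : (Fin 3 → Fin n) × (Fin 3 → Fin n) => p.1 k)
      (t := univ) (by simp)]
    push_cast
    calc β ^ 3 * (n : ℝ) ^ 5 = (β * n) * ((β * (n : ℝ) ^ 2) * (β * (n : ℝ) ^ 2)) := by ring
      _ ≤ Z.card * ((β * (n : ℝ) ^ 2) * (β * (n : ℝ) ^ 2)) := by gcongr
      _ = ∑ z ∈ Z, (β * (n : ℝ) ^ 2) * (β * (n : ℝ) ^ 2) := by rw [sum_const, nsmul_eq_mul]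
      _ ≤ _ := sum_le_sum h1
      _ ≤ _ := sum_le_sum_of_subset_of_nonneg (subset_univ _) fun _ _ _ => by positivity

/-- If two directions are linked, every triple has many absorbers. -/
lemma le_card_isAbsorber {n : ℕ} (H : (Fin 3 → Fin n) → Prop) {k l m : Fin 3}
    (hkl : k ≠ l) (hkm : k ≠ m) (hlm : l ≠ m) (β : ℝ) (hβ : 0 < β) (hβ' : β ≤ 1/3)
    (hk : linked H k β) (hl : linked H l β)
    (hL : ∀ k z, 1/3 * (n : ℝ) ^ 3 ≤ (layer H k z).card)
    (hn : 450 ≤ β ^ 6 * n) (t : Fin 3 → Fin n) :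
    β ^ 6 / 6 * (n : ℝ) ^ 12 ≤ (univ.filter fun q => IsAbsorber H t q).card := by
  have hn0 : 0 < n := by
    rcases Nat.eq_zero_or_pos n with rfl | h
    · norm_num at hn
    · exact h
  have hn' : (0 : ℝ) < n := by exact_mod_cast hn0
  set L := univ.filter fun p : Fin n × Fin n =>
    H (Function.update (Function.update t k p.1) l p.2) with hLdef
  have hLcard : 1/3 * (n : ℝ) ^ 2 ≤ L.card := by
    have h1 : (layer H m (t m)).card ≤ ((univ : Finset (Fin n)) ×ˢ L).card := by
      refine card_le_card_of_injOn (fun e => (e m, e k, e l)) ?_ ?_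
      · intro e he
        simp only [layer, coe_filter, mem_univ, true_and, Set.mem_ofPred_eq] at he
        simp only [coe_product, coe_univ, Set.mem_prod, Set.mem_univ, true_and, hLdef, coe_filter,
          mem_univ, Set.mem_ofPred_eq]
        convert he using 1
        funext j
        have : j = k ∨ j = l ∨ j = m := by omega
        obtain rfl | rfl | rfl := this
        · simp [hkl, hkm]
        · simp [hlm]
        · simp [hkm.symm, hlm.symm]
      · intro e _ e' _ h
        simp only [Prod.mk.injEq] at h
        funext j
        have : j = k ∨ j = l ∨ j = m := by omega
        obtain rfl | rfl | rfl := this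
        exacts [h.2.1, h.2.2, h.1]
    rw [card_product, card_univ, Fintype.card_fin] at h1
    have h2 := hL m (t m)
    rify at h1
    refine le_of_mul_le_mul_left (a := (n : ℝ)) ?_ hn'
    linarith
  set P := univ.filter fun p : ((Fin 3 → Fin n) × (Fin 3 → Fin n)) ×
      ((Fin 3 → Fin n) × (Fin 3 → Fin n)) => Swaps H k (t k) p.1.1 p.1.2 ∧
      Swaps H l (t l) p.2.1 p.2.2 ∧ (p.1.2 k, p.2.2 l) ∈ L with hP
  have hPcard : β ^ 6 / 3 * (n : ℝ) ^ 12 ≤ P.card := by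
    have h1 : ∀ a ∈ L, (β ^ 3 * (n : ℝ) ^ 5) * (β ^ 3 * (n : ℝ) ^ 5) ≤
        (P.filter fun p => (p.1.2 k, p.2.2 l) = a).card := by
      intro a ha
      have h2 := le_card_swaps hn0 H k β hβ.le hβ' hk (hL k) (t k) a.1
      have h3 := le_card_swaps hn0 H l β hβ.le hβ' hl (hL l) (t l) a.2
      have h4 : (univ.filter fun p : (Fin 3 → Fin n) × (Fin 3 → Fin n) =>
          Swaps H k (t k) p.1 p.2 ∧ p.2 k = a.1) ×ˢ
          (univ.filter fun p : (Fin 3 → Fin n) × (Fin 3 → Fin n) =>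
          Swaps H l (t l) p.1 p.2 ∧ p.2 l = a.2) ⊆
          P.filter fun p => (p.1.2 k, p.2.2 l) = a := by
        rintro ⟨p, p'⟩ h
        simp only [mem_product, mem_filter, mem_univ, true_and, hP] at h ⊢
        have : (p.2 k, p'.2 l) = a := Prod.ext h.1.2 h.2.2
        exact ⟨⟨h.1.1, h.2.1, by rwa [this]⟩, this⟩
      have h5 := card_le_card h4
      rw [card_product] at h5
      rify at h5
      refine le_trans ?_ h5
      gcongr
    rw [card_eq_sum_card_fiberwise (f := fun p : ((Fin 3 → Fin n) × (Fin 3 → Fin n)) ×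
      ((Fin 3 → Fin n) × (Fin 3 → Fin n)) => (p.1.2 k, p.2.2 l)) (t := L) (by
        intro p hp
        simp only [hP, coe_filter, mem_univ, true_and, Set.mem_ofPred_eq] at hp
        exact hp.2.2)]
    push_cast
    calc β ^ 6 / 3 * (n : ℝ) ^ 12
        = (1/3 * n ^ 2) * ((β ^ 3 * (n : ℝ) ^ 5) * (β ^ 3 * (n : ℝ) ^ 5)) := by ring
      _ ≤ L.card * ((β ^ 3 * (n : ℝ) ^ 5) * (β ^ 3 * (n : ℝ) ^ 5)) := by gcongr
      _ = ∑ a ∈ L, (β ^ 3 * (n : ℝ) ^ 5) * (β ^ 3 * (n : ℝ) ^ 5) := by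
        rw [sum_const, nsmul_eq_mul]
      _ ≤ _ := sum_le_sum h1
  set N := univ.filter fun q : Fin 4 → Fin 3 → Fin n =>
      ¬ ∀ j, Function.Injective fun i => extend t q i j with hN
  have hNcard := mul_card_not_injective_le t
  rw [← hN] at hNcard
  have hle : P.card ≤ ((univ.filter fun q => IsAbsorber H t q) ∪ N).card := by
    refine card_le_card_of_injOn (fun p => ![p.1.1, p.1.2, p.2.1, p.2.2]) ?_ ?_
    · rintro ⟨⟨a, b⟩, c, d⟩ hp
      simp only [hP, hLdef, coe_filter, mem_univ, true_and, Set.mem_ofPred_eq, mem_filter] at hp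
      simp only [coe_union, Set.mem_union, hN, coe_filter, mem_univ, true_and, Set.mem_ofPred_eq]
      rw [or_iff_not_imp_right, not_not]
      intro hinj
      exact isAbsorber_of_swaps H hkl t _ hinj hp.1 hp.2.1 hp.2.2
    · rintro ⟨⟨a, b⟩, c, d⟩ _ ⟨⟨a', b'⟩, c', d'⟩ _ h
      simp only at h
      have h0 := congrFun h 0
      have h1 := congrFun h 1
      have h2 := congrFun h 2
      have h3 := congrFun h 3
      simp at h0 h1 h2 h3
      simp [h0, h1, h2, h3]
  have hle2 := hle.trans (card_union_le _ _)
  rify at hle2 hNcard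
  have h5 : (N.card : ℝ) ≤ β ^ 6 / 6 * (n : ℝ) ^ 12 := by
    refine le_of_mul_le_mul_left (a := (n : ℝ)) ?_ hn'
    have : 0 ≤ (β ^ 6 * n - 450) * (n : ℝ) ^ 12 :=
      mul_nonneg (by linarith) (by positivity)
    nlinarith
  linarith

/-- Greedy selection of `m` pairwise compatible elements of `Q` such that the exponential
potential counting the related elements decreases geometrically. -/
lemma exists_selection {T Q : Type*} [Fintype T] [Fintype Q] [Nonempty T] [Nonempty Q]
    (R : T → Q → Prop) (V : Q → Prop) (conf : Q → Q → Prop) (c χ : ℝ) (hc : 0 < c)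
    (hχ : 0 ≤ χ) (hRV : ∀ t q, R t q → V q) (hrefl : ∀ q, conf q q)
    (hsymm : ∀ q q', conf q q' → conf q' q)
    (hR : ∀ t, c * Fintype.card Q ≤ (univ.filter fun q => R t q).card)
    (hconf : ∀ q, ((univ.filter fun q' => conf q q').card : ℝ) ≤ χ * Fintype.card Q) (m : ℕ)
    (hm : m * χ ≤ c / 2) :
    ∃ S : Finset Q, S.card = m ∧ (∀ q ∈ S, V q) ∧
      (∀ q ∈ S, ∀ q' ∈ S, q ≠ q' → ¬ conf q q') ∧
      ∑ t, (1/2 : ℝ) ^ (S.filter fun q => R t q).card ≤ Fintype.card T * (1 - c / 4) ^ m := by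
  have hQ : (0 : ℝ) < Fintype.card Q := by exact_mod_cast Fintype.card_pos
  induction m with
  | zero => exact ⟨∅, by simp⟩
  | succ m ih =>
    obtain ⟨S, hS, hSV, hSc, hΦ⟩ := ih (by push_cast at hm; nlinarith)
    set w : T → ℝ := fun t => (1/2 : ℝ) ^ (S.filter fun q => R t q).card with hw
    set F := univ.filter fun q => V q ∧ ∀ s ∈ S, ¬ conf s q with hF
    have h1 : ∀ t, c / 2 * Fintype.card Q ≤ (F.filter fun q => R t q).card := by
      intro t
      have h2 : (univ.filter fun q => R t q) ⊆ (F.filter fun q => R t q) ∪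
          S.biUnion fun s => univ.filter fun q => conf s q := by
        intro q hq
        simp only [mem_union, mem_filter, mem_univ, true_and, mem_biUnion, hF] at hq ⊢
        by_cases h : ∃ s ∈ S, conf s q
        · exact Or.inr h
        · push Not at h
          exact Or.inl ⟨⟨hRV t q hq, h⟩, hq⟩
      have h3 := (card_le_card h2).trans ((card_union_le _ _).trans
        (Nat.add_le_add_left card_biUnion_le _))
      rify at h3
      have h4 : ∑ s ∈ S, ((univ.filter fun q => conf s q).card : ℝ)
          ≤ ∑ s ∈ S, χ * Fintype.card Q := sum_le_sum fun s _ => hconf s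
      rw [sum_const, nsmul_eq_mul, hS] at h4
      have h5 := hR t
      have h6 : m * χ * Fintype.card Q ≤ c / 2 * Fintype.card Q := by
        refine mul_le_mul_of_nonneg_right ?_ hQ.le
        push_cast at hm; linarith
      linarith
    have h2 : F.Nonempty := by
      obtain ⟨t⟩ := ‹Nonempty T›
      have h3 := h1 t
      by_contra h
      rw [not_nonempty_iff_eq_empty] at h
      rw [h] at h3
      simp at h3
      have : 0 < c / 2 * Fintype.card Q := by positivity
      linarith
    have hw0 : ∀ t, 0 ≤ w t := fun t => by positivity
    have h3 : ∑ _q ∈ F, c / 2 * ∑ t, w t ≤ ∑ q ∈ F, ∑ t, if R t q then w t else 0 := by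
      rw [sum_comm, sum_const, nsmul_eq_mul]
      calc (F.card : ℝ) * (c / 2 * ∑ t, w t)
          ≤ Fintype.card Q * (c / 2 * ∑ t, w t) := by
            have : 0 ≤ ∑ t, w t := sum_nonneg fun t _ => hw0 t
            gcongr
            exact_mod_cast card_le_univ F
        _ = ∑ t, c / 2 * Fintype.card Q * w t := by rw [← mul_sum]; ring
        _ ≤ _ := by
            refine sum_le_sum fun t _ => ?_
            rw [← sum_filter, sum_const, nsmul_eq_mul]
            exact mul_le_mul_of_nonneg_right (h1 t) (hw0 t)
    obtain ⟨q, hq, hqs⟩ := exists_le_of_sum_le h2 h3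
    simp only [hF, mem_filter, mem_univ, true_and] at hq
    have hqS : q ∉ S := fun h => hq.2 q h (hrefl q)
    refine ⟨insert q S, by rw [card_insert_of_notMem hqS, hS], ?_, ?_, ?_⟩
    · intro q' hq'
      rcases mem_insert.1 hq' with rfl | h
      exacts [hq.1, hSV _ h]
    · intro a ha b hb hab
      rcases mem_insert.1 ha with ha' | ha' <;> rcases mem_insert.1 hb with hb' | hb'
      · exact absurd (ha'.trans hb'.symm) hab
      · rw [ha']; exact fun h => hq.2 b hb' (hsymm _ _ h)
      · rw [hb']; exact hq.2 a ha'
      · exact hSc a ha' b hb' hab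
    · have h4 : ∀ t, (1/2 : ℝ) ^ ((insert q S).filter fun q => R t q).card
          = w t - 1/2 * if R t q then w t else 0 := by
        intro t
        rw [filter_insert]
        split_ifs with h
        · rw [card_insert_of_notMem (by simp [hqS]), pow_succ]; ring
        · simp [hw]
      simp only [h4]
      rw [sum_sub_distrib, ← mul_sum]
      have hc4 : c ≤ 1 := by
        obtain ⟨t⟩ := ‹Nonempty T›
        have h5 : ((univ.filter fun q => R t q).card : ℝ) ≤ Fintype.card Q := by
          exact_mod_cast card_le_univ _
        have := (hR t).trans h5
        by_contra h
        push Not at h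
        nlinarith
      calc ∑ t, w t - 1/2 * ∑ t, (if R t q then w t else 0)
          ≤ (∑ t, w t) * (1 - c / 4) := by linarith
        _ ≤ (Fintype.card T * (1 - c / 4) ^ m) * (1 - c / 4) := by
            refine mul_le_mul_of_nonneg_right hΦ (by linarith)
        _ = _ := by ring

/-- Two quadruples of triples share a vertex. -/
def Meets {n : ℕ} (q q' : Fin 4 → Fin 3 → Fin n) : Prop :=
  ∃ i i' j, q i j = q' i' j

lemma mul_card_meets_le {n : ℕ} (q : Fin 4 → Fin 3 → Fin n) :
    n * (univ.filter fun q' => Meets q q').card ≤ 48 * n ^ 12 := by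
  have hsub : (univ.filter fun q' => Meets q q') ⊆
      (univ : Finset (Fin 4 × Fin 4 × Fin 3)).biUnion fun a => univ.filter fun q' =>
        q' a.2.1 a.2.2 = q a.1 a.2.2 := by
    intro q' hq
    simp only [mem_filter, mem_univ, true_and] at hq
    obtain ⟨i, i', j, h⟩ := hq
    simp only [mem_biUnion, mem_univ, mem_filter, true_and]
    exact ⟨(i, i', j), h.symm⟩
  have h := (card_le_card hsub).trans card_biUnion_le
  calc n * _ ≤ n * _ := Nat.mul_le_mul_left n h
    _ ≤ ∑ _a : Fin 4 × Fin 4 × Fin 3, n ^ 12 := by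
      rw [mul_sum]
      exact sum_le_sum fun a _ => mul_card_coordinate_eq_le _ _ (fun _ => q a.1 a.2.2)
        fun _ _ => rfl
    _ = 48 * n ^ 12 := by simp

/-- If every triple has many absorbers, there is a small family of disjoint quadruples
containing linearly many absorbers for every triple. -/
lemma exists_absorbing_family (c ζ : ℝ) (hc : 0 < c) (hζ : 0 < ζ) :
    ∃ κ : ℝ, 0 < κ ∧ ∃ n₀ : ℕ, ∀ n : ℕ, n₀ ≤ n → ∀ H : (Fin 3 → Fin n) → Prop,
      (∀ t, c * (n : ℝ) ^ 12 ≤ (univ.filter fun q => IsAbsorber H t q).card) →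
      ∃ S : Finset (Fin 4 → Fin 3 → Fin n), (S.card : ℝ) ≤ ζ * n ∧
        (∀ q ∈ S, (∀ i, H (q i)) ∧ ∀ j, Function.Injective fun i => q i j) ∧
        (∀ q ∈ S, ∀ q' ∈ S, q ≠ q' → ¬ Meets q q') ∧
        ∀ t, κ * n ≤ (S.filter fun q => IsAbsorber H t q).card := by
  set ξ := min ζ (c / 96) with hξ
  have hξ0 : 0 < ξ := lt_min hζ (by positivity)
  set θ := c * ξ / 16 with hθ
  have hθ0 : 0 < θ := by positivity
  have hexp : ∀ᶠ n : ℕ in Filter.atTop, (n : ℝ) ^ 3 < Real.exp (θ * n) := by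
    have h := (isLittleO_pow_exp_pos_mul_atTop 3 hθ0).bound (c := 1/2) (by norm_num)
    have h2 := tendsto_natCast_atTop_atTop (R := ℝ) |>.eventually h
    filter_upwards [h2] with n hn
    rw [Real.norm_of_nonneg (by positivity), Real.norm_of_nonneg (by positivity)] at hn
    have := Real.exp_pos (θ * n)
    linarith
  obtain ⟨n₁, hn₁⟩ := Filter.eventually_atTop.1 hexp
  obtain ⟨n₂, hn₂⟩ := exists_nat_ge (2 / ξ)
  refine ⟨θ, hθ0, max n₁ (max n₂ 1), fun n hn H hH => ?_⟩
  have hn1 : (n : ℝ) ^ 3 < Real.exp (θ * n) := hn₁ n (by omega)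
  have hn2 : 2 ≤ ξ * n := by
    have h : (2 / ξ : ℝ) ≤ n := hn₂.trans (by exact_mod_cast (by omega : n₂ ≤ n))
    rw [div_le_iff₀ hξ0] at h; linarith
  have hn0 : 0 < n := by omega
  have hn' : (0 : ℝ) < n := by exact_mod_cast hn0
  have : Nonempty (Fin n) := ⟨⟨0, hn0⟩⟩
  set m := ⌊ξ * n⌋₊ with hm
  have hm1 : (m : ℝ) ≤ ξ * n := Nat.floor_le (by positivity)
  have hm2 : ξ * n / 2 ≤ m := by
    have := Nat.lt_floor_add_one (ξ * n)
    linarith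
  have hQ : (Fintype.card (Fin 4 → Fin 3 → Fin n) : ℝ) = (n : ℝ) ^ 12 := by
    simp [← pow_mul]
  have hRV : ∀ t q, IsAbsorber H t q →
      (∀ i, H (q i)) ∧ ∀ j, Function.Injective fun i => q i j := by
    rintro t q ⟨h1, h2, -⟩
    refine ⟨h2, fun j i i' h => ?_⟩
    have := h1 j (a₁ := i.succ) (a₂ := i'.succ) (by simpa [extend] using h)
    simpa using this
  have hsymm : ∀ q q' : Fin 4 → Fin 3 → Fin n, Meets q q' → Meets q' q := by
    rintro q q' ⟨i, i', j, h⟩; exact ⟨i', i, j, h.symm⟩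
  have hmeets : ∀ q : Fin 4 → Fin 3 → Fin n, ((univ.filter fun q' => Meets q q').card : ℝ)
      ≤ 48 / n * Fintype.card (Fin 4 → Fin 3 → Fin n) := by
    intro q
    rw [hQ]
    have h := mul_card_meets_le q
    rify at h
    rw [div_mul_eq_mul_div, le_div_iff₀ hn']
    linarith
  have hmχ : (m : ℝ) * (48 / n) ≤ c / 2 := by
    calc (m : ℝ) * (48 / n) ≤ (c / 96 * n) * (48 / n) := by
          gcongr
          exact hm1.trans (mul_le_mul_of_nonneg_right (min_le_right _ _) hn'.le)
      _ = c / 2 := by field_simp; norm_num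
  obtain ⟨S, hS, hSV, hSc, hΦ⟩ := exists_selection (fun t q => IsAbsorber H t q)
    (fun q => (∀ i, H (q i)) ∧ ∀ j, Function.Injective fun i => q i j) Meets c (48 / n) hc
    (by positivity) hRV (fun q => ⟨0, 0, 0, rfl⟩) hsymm (by rw [hQ]; exact hH) hmeets m hmχ
  refine ⟨S, ?_, hSV, hSc, fun t => ?_⟩
  · rw [hS]
    exact hm1.trans (mul_le_mul_of_nonneg_right (min_le_left _ _) hn'.le)
  · by_contra hcon
    push Not at hcon
    set a := (S.filter fun q => IsAbsorber H t q).card with ha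
    have h1 : (1/2 : ℝ) ^ a ≤ (n : ℝ) ^ 3 * (1 - c / 4) ^ m := by
      refine le_trans ?_ (hΦ.trans (le_of_eq (by simp)))
      exact single_le_sum (f := fun t => (1/2 : ℝ) ^ (S.filter fun q => IsAbsorber H t q).card)
        (fun t _ => by positivity) (mem_univ t)
    have hc4 : c ≤ 1 := by
      have h5 := (hH t).trans (Nat.cast_le.2 (card_le_univ _))
      rw [hQ] at h5
      have : (0 : ℝ) < (n : ℝ) ^ 12 := by positivity
      by_contra h
      push Not at h
      nlinarith
    have h2 : (1 - c / 4) ^ m ≤ Real.exp (-(c / 4 * m)) := by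
      have h3 : 1 - c / 4 ≤ Real.exp (-(c / 4)) := by
        have := Real.add_one_le_exp (-(c / 4)); linarith
      calc (1 - c / 4) ^ m ≤ Real.exp (-(c / 4)) ^ m :=
            pow_le_pow_left₀ (by linarith) h3 m
        _ = _ := by rw [← Real.exp_nat_mul]; congr 1; ring
    have h3 : Real.exp (-(a : ℝ)) ≤ (1/2 : ℝ) ^ a := by
      have h4 : Real.exp (-1) ≤ 1/2 := by
        rw [Real.exp_neg, one_div]
        exact inv_anti₀ (by norm_num) (by have := Real.add_one_le_exp 1; linarith)
      calc Real.exp (-(a : ℝ)) = Real.exp (-1) ^ a := by rw [← Real.exp_nat_mul]; congr 1; ring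
        _ ≤ _ := pow_le_pow_left₀ (Real.exp_pos _).le h4 a
    have h4 : Real.exp (-(a : ℝ)) < Real.exp (θ * n) * Real.exp (-(c / 4 * m)) :=
      calc Real.exp (-(a : ℝ)) ≤ (n : ℝ) ^ 3 * Real.exp (-(c / 4 * m)) :=
            h3.trans (h1.trans (by gcongr))
        _ < _ := by gcongr
    rw [← Real.exp_add, Real.exp_lt_exp] at h4
    have h5 : c / 4 * (ξ * n / 2) ≤ c / 4 * m := by gcongr
    have h6 : θ * n * 2 = c / 4 * (ξ * n / 2) := by rw [hθ]; ring
    linarith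

/-- `M` is a matching of the `3`-partite `3`-graph `H`. -/
def IsMatch {n : ℕ} (H : (Fin 3 → Fin n) → Prop) (M : Finset (Fin 3 → Fin n)) : Prop :=
  (∀ e ∈ M, H e) ∧ ∀ j, ∀ e ∈ M, ∀ e' ∈ M, e j = e' j → e = e'

lemma IsMatch.card_image {n : ℕ} {H : (Fin 3 → Fin n) → Prop} {M : Finset (Fin 3 → Fin n)}
    (hM : IsMatch H M) (j : Fin 3) {S : Finset (Fin 3 → Fin n)} (hS : S ⊆ M) :
    (S.image fun e => e j).card = S.card :=
  card_image_of_injOn fun e he e' he' h => hM.2 j e (hS he) e' (hS he') h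

lemma IsMatch.card_le {n : ℕ} {H : (Fin 3 → Fin n) → Prop} {M : Finset (Fin 3 → Fin n)}
    (hM : IsMatch H M) : M.card ≤ n := by
  rw [← hM.card_image 0 subset_rfl]
  simpa using card_le_univ (M.image fun e => e 0)

/-- Replacing the edges `R` of a matching by the edges `p`. -/
lemma IsMatch.replace {n r : ℕ} {H : (Fin 3 → Fin n) → Prop} {M R : Finset (Fin 3 → Fin n)}
    (hM : IsMatch H M) (hR : R ⊆ M) (p : Fin r → Fin 3 → Fin n) (hp : ∀ s, H (p s))
    (hinj : ∀ j, Function.Injective fun s => p s j)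
    (hfree : ∀ s j, (∃ e ∈ R, p s j = e j) ∨ ∀ e ∈ M, p s j ≠ e j) :
    IsMatch H ((M \ R) ∪ univ.image p) ∧
      ((M \ R) ∪ univ.image p).card + R.card = M.card + r := by
  have hne : ∀ e ∈ M \ R, ∀ s j, p s j ≠ e j := by
    intro e he s j h
    rw [mem_sdiff] at he
    rcases hfree s j with ⟨e', he', h'⟩ | h'
    · exact he.2 (hM.2 j e he.1 e' (hR he') (h.symm.trans h') ▸ he')
    · exact h' e he.1 h
  refine ⟨⟨?_, ?_⟩, ?_⟩
  · intro e he
    rcases mem_union.1 he with h | h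
    · exact hM.1 e (mem_sdiff.1 h).1
    · obtain ⟨s, -, rfl⟩ := mem_image.1 h
      exact hp s
  · intro j e he e' he' h
    rcases mem_union.1 he with h1 | h1 <;> rcases mem_union.1 he' with h2 | h2
    · exact hM.2 j e (mem_sdiff.1 h1).1 e' (mem_sdiff.1 h2).1 h
    · obtain ⟨s, -, rfl⟩ := mem_image.1 h2
      exact absurd h.symm (hne e h1 s j)
    · obtain ⟨s, -, rfl⟩ := mem_image.1 h1
      exact absurd h (hne e' h2 s j)
    · obtain ⟨s, -, rfl⟩ := mem_image.1 h1
      obtain ⟨s', -, rfl⟩ := mem_image.1 h2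
      rw [hinj j h]
  · have hdisj : Disjoint (M \ R) (univ.image p) := by
      rw [disjoint_left]
      intro e he h
      obtain ⟨s, -, rfl⟩ := mem_image.1 h
      exact hne _ he s 0 rfl
    have hpinj : Function.Injective p := fun s s' h => hinj 0 (congrFun h 0)
    rw [card_union_of_disjoint hdisj, card_image_of_injective _ hpinj, card_univ,
      Fintype.card_fin, card_sdiff_of_subset hR]
    have := card_le_card hR
    omega

lemma exists_unmatched {n : ℕ} {H : (Fin 3 → Fin n) → Prop} {M : Finset (Fin 3 → Fin n)}
    (hM : IsMatch H M) (j : Fin 3) (B : Finset (Fin n)) (hB : B.card + M.card < n) :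
    ∃ v, (∀ e ∈ M, v ≠ e j) ∧ v ∉ B := by
  have h : (B ∪ M.image fun e => e j).card < (univ : Finset (Fin n)).card := by
    refine (card_union_le _ _).trans_lt ?_
    rw [hM.card_image j subset_rfl, card_univ, Fintype.card_fin]
    exact hB
  obtain ⟨v, -, hv⟩ := exists_mem_notMem_of_card_lt_card h
  simp only [mem_union, mem_image, not_or, not_exists, not_and] at hv
  exact ⟨v, fun e he h => hv.2 e he h.symm, hv.1⟩

lemma injective_of_pairwise {α : Type*} {f : Fin 4 → α} (h01 : f 0 ≠ f 1) (h02 : f 0 ≠ f 2)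
    (h03 : f 0 ≠ f 3) (h12 : f 1 ≠ f 2) (h13 : f 1 ≠ f 3) (h23 : f 2 ≠ f 3) :
    Function.Injective f := by
  intro s s' h
  fin_cases s <;> fin_cases s' <;> first | rfl | exact absurd h ‹_› | exact absurd h.symm ‹_›

/-- The four edges replacing three edges of a matching in an augmentation. -/
lemma augmentation_free {n : ℕ} {M : Finset (Fin 3 → Fin n)} {e e' f : Fin 3 → Fin n}
    (he : e ∈ M) (he' : e' ∈ M) (hf : f ∈ M) (hee : ∀ j, e j ≠ e' j)
    {x y i v w i₀ j₀ : Fin n} (hx : x = f 0 ∧ (∀ j, f j ≠ e j) ∧ (∀ j, f j ≠ e' j) ∨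
      ∀ e ∈ M, x ≠ e 0)
    (hy : y = f 1 ∧ (∀ j, f j ≠ e j) ∧ (∀ j, f j ≠ e' j) ∨ ∀ e ∈ M, y ≠ e 1)
    (hi : ∀ e ∈ M, i ≠ e 2) (hv : ∀ e ∈ M, v ≠ e 0) (hw : ∀ e ∈ M, w ≠ e 1)
    (hi₀ : ∀ e ∈ M, i₀ ≠ e 2) (hj₀ : ∀ e ∈ M, j₀ ≠ e 2) (hxv : x ≠ v) (hyw : y ≠ w)
    (hii : i ≠ i₀) (hij : i ≠ j₀) (hij₀ : i₀ ≠ j₀) :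
    (∀ j, Function.Injective fun s =>
      (![![x, y, i], ![v, e 1, i₀], ![e' 0, w, j₀], ![e 0, e' 1, f 2]] :
        Fin 4 → Fin 3 → Fin n) s j) ∧
    ∀ s j, (∃ r ∈ ({e, e', f} : Finset (Fin 3 → Fin n)),
      (![![x, y, i], ![v, e 1, i₀], ![e' 0, w, j₀], ![e 0, e' 1, f 2]] :
        Fin 4 → Fin 3 → Fin n) s j = r j) ∨ ∀ r ∈ M,
      (![![x, y, i], ![v, e 1, i₀], ![e' 0, w, j₀], ![e 0, e' 1, f 2]] :
        Fin 4 → Fin 3 → Fin n) s j ≠ r j := by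
  have x1 : x ≠ e 0 ∧ x ≠ e' 0 := by
    rcases hx with ⟨rfl, h, h'⟩ | h
    exacts [⟨h 0, h' 0⟩, ⟨h e he, h e' he'⟩]
  have y1 : y ≠ e 1 ∧ y ≠ e' 1 := by
    rcases hy with ⟨rfl, h, h'⟩ | h
    exacts [⟨h 1, h' 1⟩, ⟨h e he, h e' he'⟩]
  constructor
  · intro j
    obtain rfl | rfl | rfl : j = 0 ∨ j = 1 ∨ j = 2 := by omega
    · exact injective_of_pairwise hxv x1.2 x1.1 (hv e' he') (hv e he) (hee 0).symm
    · exact injective_of_pairwise y1.1 hyw y1.2 (hw e he).symm (hee 1) (hw e' he')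
    · exact injective_of_pairwise hii hij (hi f hf) hij₀ (hi₀ f hf) (hj₀ f hf)
  · have R : ∀ r ∈ ({e, e', f} : Finset (Fin 3 → Fin n)), ∀ j,
        ∃ r' ∈ ({e, e', f} : Finset (Fin 3 → Fin n)), r j = r' j := fun r hr j => ⟨r, hr, rfl⟩
    have Re := R e (by simp)
    have Re' := R e' (by simp)
    have Rf := R f (by simp)
    intro s j
    fin_cases s <;> fin_cases j
    · exact hx.imp (fun h => by rw [h.1]; exact Rf 0) id
    · exact hy.imp (fun h => by rw [h.1]; exact Rf 1) id
    · exact Or.inr hi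
    · exact Or.inr hv
    · exact Or.inl (Re 1)
    · exact Or.inr hi₀
    · exact Or.inl (Re' 0)
    · exact Or.inr hw
    · exact Or.inr hj₀
    · exact Or.inl (Re 0)
    · exact Or.inl (Re' 1)
    · exact Or.inl (Rf 2)

/-- A maximum matching containing a prescribed one misses few vertices, unless the collection
is commonly extremal. -/
lemma nearly_perfect_or_commonExtremal {n : ℕ} (G : Fin n → Fin n → Fin n → Prop)
    (η μ d κ a : ℝ) (hμa : 2 * μ + 2 * a ≤ η) (hμ : 0 ≤ μ) (ha : 0 ≤ a)
    (hn : 2 ≤ η * n) (hκ : d * n + 4 ≤ κ * n)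
    (hR : ∀ v, ((univ.filter fun i => (dR (G i) v : ℝ) < (1/2 - μ) * n).card : ℝ) ≤ d * n)
    (hL : ∀ w, ((univ.filter fun i => (dL (G i) w : ℝ) < (1/2 - μ) * n).card : ℝ) ≤ d * n)
    (A : Finset (Fin 3 → Fin n)) (hA : IsMatch (colorGraph G) A) (hAn : (A.card : ℝ) ≤ a * n) :
    (∃ M, IsMatch (colorGraph G) M ∧ A ⊆ M ∧ (n : ℝ) - M.card ≤ κ * n) ∨
      commonExtremal η G := by
  obtain ⟨M, hMmem, hmax⟩ := exists_max_image
    (univ.filter fun M => IsMatch (colorGraph G) M ∧ A ⊆ M) card ⟨A, by simp [hA]⟩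
  simp only [mem_filter, mem_univ, true_and] at hMmem hmax
  obtain ⟨hM, hAM⟩ := hMmem
  rw [or_iff_not_imp_left]
  intro hcon
  have hbig : κ * n < (n : ℝ) - M.card := by
    by_contra h
    exact hcon ⟨M, hM, hAM, by linarith⟩
  have hnoaug : ∀ (R : Finset (Fin 3 → Fin n)) (r : ℕ) (p : Fin r → Fin 3 → Fin n),
      R ⊆ M \ A → R.card < r → (∀ s, colorGraph G (p s)) →
      (∀ j, Function.Injective fun s => p s j) →
      (∀ s j, (∃ e ∈ R, p s j = e j) ∨ ∀ e ∈ M, p s j ≠ e j) → False := by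
    intro R r p hR hr hp hinj hfree
    obtain ⟨h1, h2⟩ := hM.replace (hR.trans sdiff_subset) p hp hinj hfree
    have h3 := hmax _ ⟨h1, fun e he => mem_union_left _ (mem_sdiff.2 ⟨hAM he, fun h =>
      (mem_sdiff.1 (hR h)).2 he⟩)⟩
    omega
  have hpick : ∀ (j : Fin 3) (B : Finset (Fin n)), (B.card : ℝ) ≤ d * n + 4 →
      ∃ v, (∀ e ∈ M, v ≠ e j) ∧ v ∉ B := by
    intro j B hB
    refine exists_unmatched hM j B ?_
    have : (B.card : ℝ) + M.card < n := by linarith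
    exact_mod_cast this
  have hpick2 : ∀ (f : Fin n → ℕ) (B : Finset (Fin n)),
      ((univ.filter fun i => (f i : ℝ) < (1/2 - μ) * n).card : ℝ) ≤ d * n → B.card ≤ 4 →
      ∃ i, (∀ e ∈ M, i ≠ e 2) ∧ (1/2 - μ) * (n : ℝ) ≤ f i ∧ i ∉ B := by
    intro f B hf hB
    obtain ⟨i, h1, h2⟩ := hpick 2 ((univ.filter fun i => (f i : ℝ) < (1/2 - μ) * n) ∪ B) (by
      have h3 := card_union_le (univ.filter fun i => (f i : ℝ) < (1/2 - μ) * n) B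
      rify at h3 hB
      linarith)
    simp only [mem_union, mem_filter, mem_univ, true_and, not_or, not_lt] at h2
    exact ⟨i, h1, h2.1, h2.2⟩
  have hdn : 0 ≤ d * n ∨ n = 0 := by
    rcases Nat.eq_zero_or_pos n with h | h
    · exact Or.inr h
    · exact Or.inl (le_trans (by positivity) (hR ⟨0, h⟩))
  have hdn : 0 ≤ d * n := by
    rcases hdn with h | h
    · exact h
    · simp [h]
  obtain ⟨v₀, hv₀, -⟩ := hpick 0 ∅ (by simp; linarith)
  obtain ⟨v₁, hv₁, hv⟩ := hpick 0 {v₀} (by simp; linarith)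
  obtain ⟨w₀, hw₀, -⟩ := hpick 1 ∅ (by simp; linarith)
  obtain ⟨w₁, hw₁, hw⟩ := hpick 1 {w₀} (by simp; linarith)
  obtain ⟨i₀, hi₀, di₀, -⟩ := hpick2 (fun i => dR (G i) v₀) ∅ (hR v₀) (by simp)
  obtain ⟨i₁, hi₁, di₁, hii⟩ := hpick2 (fun i => dR (G i) v₁) {i₀} (hR v₁) (by simp)
  obtain ⟨j₀, hj₀, dj₀, hji⟩ := hpick2 (fun i => dL (G i) w₀) {i₀, i₁} (hL w₀)
    (card_le_two.trans (by norm_num))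
  obtain ⟨j₁, hj₁, dj₁, hjj⟩ := hpick2 (fun i => dL (G i) w₁) {i₀, i₁, j₀} (hL w₁)
    (card_le_three.trans (by norm_num))
  simp only [mem_singleton, mem_insert, not_or] at hv hw hii hji hjj
  have hS : ∀ v i, (∀ e ∈ M, v ≠ e 0) → (∀ e ∈ M, i ≠ e 2) → (1/2 - μ) * (n : ℝ) ≤ dR (G i) v →
      (1/2 - μ - a) * (n : ℝ) ≤ ((M \ A).filter fun e => G i v (e 1)).card := by
    intro v i hv hi hd
    have h1 : (univ.filter fun w => G i v w) ⊆
        (((M \ A).filter fun e => G i v (e 1)).image fun e => e 1) ∪ A.image fun e => e 1 := by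
      intro w hw
      simp only [mem_filter, mem_univ, true_and] at hw
      by_contra hnot
      simp only [mem_union, mem_image, mem_filter, mem_sdiff, not_or, not_exists, not_and] at hnot
      have hfree : ∀ e ∈ M, w ≠ e 1 := by
        rintro e he rfl
        exact hnot.1 e ⟨⟨he, fun h => hnot.2 e h rfl⟩, hw⟩ rfl
      refine hnoaug ∅ 1 (fun _ => ![v, w, i]) (by simp) (by simp) (fun _ => hw)
        (fun j s s' _ => Subsingleton.elim _ _) fun s j => Or.inr ?_
      fin_cases j
      exacts [hv, hfree, hi]
    have h2 := (card_le_card h1).trans (card_union_le _ _)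
    rw [← dR_eq, hM.card_image 1 ((filter_subset _ _).trans sdiff_subset),
      hM.card_image 1 hAM] at h2
    rify at h2
    linarith
  have hT : ∀ w i, (∀ e ∈ M, w ≠ e 1) → (∀ e ∈ M, i ≠ e 2) → (1/2 - μ) * (n : ℝ) ≤ dL (G i) w →
      (1/2 - μ - a) * (n : ℝ) ≤ ((M \ A).filter fun e => G i (e 0) w).card := by
    intro w i hw hi hd
    have h1 : (univ.filter fun v => G i v w) ⊆
        (((M \ A).filter fun e => G i (e 0) w).image fun e => e 0) ∪ A.image fun e => e 0 := by
      intro v hv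
      simp only [mem_filter, mem_univ, true_and] at hv
      by_contra hnot
      simp only [mem_union, mem_image, mem_filter, mem_sdiff, not_or, not_exists, not_and] at hnot
      have hfree : ∀ e ∈ M, v ≠ e 0 := by
        rintro e he rfl
        exact hnot.1 e ⟨⟨he, fun h => hnot.2 e h rfl⟩, hv⟩ rfl
      refine hnoaug ∅ 1 (fun _ => ![v, w, i]) (by simp) (by simp) (fun _ => hv)
        (fun j s s' _ => Subsingleton.elim _ _) fun s j => Or.inr ?_
      fin_cases j
      exacts [hfree, hw, hi]
    have h2 := (card_le_card h1).trans (card_union_le _ _)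
    rw [← dL_eq, hM.card_image 0 ((filter_subset _ _).trans sdiff_subset),
      hM.card_image 0 hAM] at h2
    rify at h2
    linarith
  have hdisj : ∀ v w i j, (∀ e ∈ M, v ≠ e 0) → (∀ e ∈ M, w ≠ e 1) → (∀ e ∈ M, i ≠ e 2) →
      (∀ e ∈ M, j ≠ e 2) → i ≠ j →
      Disjoint ((M \ A).filter fun e => G i v (e 1)) ((M \ A).filter fun e => G j (e 0) w) := by
    intro v w i j hv hw hi hj hij
    rw [disjoint_left]
    intro e he he'
    simp only [mem_filter] at he he'
    have heM := (mem_sdiff.1 he.1).1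
    refine hnoaug {e} 2 ![![v, e 1, i], ![e 0, w, j]] (by simpa using he.1) (by simp) ?_ ?_ ?_
    · intro s; fin_cases s
      exacts [he.2, he'.2]
    · have := hv e heM
      have := hw e heM
      intro k s s'
      fin_cases k <;> fin_cases s <;> fin_cases s' <;> simp <;> grind
    · intro s k
      fin_cases s <;> fin_cases k <;> simp <;> grind
  set S₀ := (M \ A).filter fun e => G i₀ v₀ (e 1) with hS₀
  set S₁ := (M \ A).filter fun e => G i₁ v₁ (e 1) with hS₁
  set T₀ := (M \ A).filter fun e => G j₀ (e 0) w₀ with hT₀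
  set T₁ := (M \ A).filter fun e => G j₁ (e 0) w₁ with hT₁
  have cS₀ := hS v₀ i₀ hv₀ hi₀ di₀
  have cS₁ := hS v₁ i₁ hv₁ hi₁ di₁
  have cT₀ := hT w₀ j₀ hw₀ hj₀ dj₀
  have cT₁ := hT w₁ j₁ hw₁ hj₁ dj₁
  have D₀ := hdisj v₀ w₀ i₀ j₀ hv₀ hw₀ hi₀ hj₀ (Ne.symm hji.1)
  have D₁ := hdisj v₁ w₁ i₁ j₁ hv₁ hw₁ hi₁ hj₁ (Ne.symm hjj.2.1)
  have sub : ∀ P : (Fin 3 → Fin n) → Prop, (M \ A).filter P ⊆ M :=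
    fun P => (filter_subset _ _).trans sdiff_subset
  have hedge : ∀ e ∈ S₀, ∀ e' ∈ T₀, ∀ f ∈ S₁ ∪ T₁, f ≠ e → f ≠ e' →
      ¬ G (f 2) (e 0) (e' 1) := by
    intro e he e' he' f hf hfe hfe' hG
    have hee : e ≠ e' := by rintro rfl; exact disjoint_left.1 D₀ he he'
    simp only [hS₀, hT₀, hS₁, hT₁, mem_filter, mem_union, mem_sdiff] at he he' hf
    obtain ⟨⟨heM, heA⟩, hGe⟩ := he
    obtain ⟨⟨heM', heA'⟩, hGe'⟩ := he'
    have hfM : f ∈ M ∧ f ∉ A := by tauto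
    have ne1 : ∀ j, e j ≠ e' j := fun j h => hee (hM.2 j _ heM _ heM' h)
    have ne2 : ∀ j, f j ≠ e j := fun j h => hfe (hM.2 j _ hfM.1 _ heM h)
    have ne3 : ∀ j, f j ≠ e' j := fun j h => hfe' (hM.2 j _ hfM.1 _ heM' h)
    have hsub : ({e, e', f} : Finset (Fin 3 → Fin n)) ⊆ M \ A := by
      intro x hx
      simp only [mem_insert, mem_singleton] at hx
      rw [mem_sdiff]
      rcases hx with rfl | rfl | rfl
      exacts [⟨heM, heA⟩, ⟨heM', heA'⟩, hfM]
    have hcard : ({e, e', f} : Finset (Fin 3 → Fin n)).card < 4 :=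
      card_le_three.trans_lt (by norm_num)
    rcases hf with ⟨-, hf⟩ | ⟨-, hf⟩
    · obtain ⟨h1, h2⟩ := augmentation_free heM heM' hfM.1 ne1 (Or.inr hv₁)
        (Or.inl ⟨rfl, ne2, ne3⟩) hi₁ hv₀ hw₀ hi₀ hj₀ hv (hw₀ f hfM.1).symm hii
        (Ne.symm hji.2) (Ne.symm hji.1)
      refine hnoaug {e, e', f} 4 _ hsub hcard ?_ h1 h2
      intro s; fin_cases s
      exacts [hf, hGe, hGe', hG]
    · obtain ⟨h1, h2⟩ := augmentation_free heM heM' hfM.1 ne1 (Or.inl ⟨rfl, ne2, ne3⟩)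
        (Or.inr hw₁) hj₁ hv₀ hw₀ hi₀ hj₀ (hv₀ f hfM.1).symm hw hjj.1 hjj.2.2 (Ne.symm hji.1)
      refine hnoaug {e, e', f} 4 _ hsub hcard ?_ h1 h2
      intro s; fin_cases s
      exacts [hf, hGe, hGe', hG]
  have hMn := hM.card_le
  have hsum₀ : S₀.card + T₀.card ≤ M.card := by
    rw [← card_union_of_disjoint D₀]; exact card_le_card (union_subset (sub _) (sub _))
  have hsum₁ : S₁.card + T₁.card = (S₁ ∪ T₁).card := (card_union_of_disjoint D₁).symm
  rify at hsum₀ hsum₁ hMn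
  have hn' : (0 : ℝ) ≤ n := by positivity
  have hηn : 2 * μ * n + 2 * (a * n) ≤ η * n := by nlinarith
  have hμn : 0 ≤ μ * n := by positivity
  have han : 0 ≤ a * n := by positivity
  refine ⟨S₀.image fun e => e 0, T₀.image fun e => e 1, ?_, ?_, ?_⟩
  · rw [hM.card_image 0 (sub _)]
    constructor <;> linarith
  · rw [hM.card_image 1 (sub _)]
    constructor <;> linarith
  · have hsub : (univ.filter fun c => ¬ ((eBip (G c) (S₀.image fun e => e 0)
        (T₀.image fun e => e 1) : ℝ) ≤ η * (n : ℝ) ^ 2 ∨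
        (eBip (G c) (S₀.image fun e => e 0) (T₀.image fun e => e 1)ᶜ : ℝ) ≤ η * (n : ℝ) ^ 2))
        ⊆ ((S₁ ∪ T₁).image fun e => e 2)ᶜ := by
      intro c hc
      simp only [mem_filter, mem_univ, true_and, not_or] at hc
      rw [mem_compl]
      intro hmem
      obtain ⟨f, hf, rfl⟩ := mem_image.1 hmem
      refine hc.1 ?_
      have h1 : eBip (G (f 2)) (S₀.image fun e => e 0) (T₀.image fun e => e 1) ≤ 2 * n := by
        rw [eBip_eq]
        have h2 : (univ.filter fun p : Fin n × Fin n => p.1 ∈ S₀.image (fun e => e 0) ∧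
            p.2 ∈ T₀.image (fun e => e 1) ∧ G (f 2) p.1 p.2) ⊆
            ({f 0} ×ˢ univ) ∪ (univ ×ˢ {f 1}) := by
          rintro ⟨x, y⟩ hp
          simp only [mem_filter, mem_univ, true_and, mem_image] at hp
          obtain ⟨⟨e, he, rfl⟩, ⟨e', he', rfl⟩, hG⟩ := hp
          simp only [mem_union, mem_product, mem_singleton, mem_univ, and_true, true_and]
          by_contra hnot
          rw [not_or] at hnot
          refine hedge e he e' he' f hf ?_ ?_ hG
          · rintro rfl; exact hnot.1 rfl
          · rintro rfl; exact hnot.2 rfl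
        refine (card_le_card h2).trans ((card_union_le _ _).trans ?_)
        simp; omega
      rify at h1
      nlinarith
    have h1 := card_le_card hsub
    rw [card_compl, Fintype.card_fin, hM.card_image 2 (union_subset (sub _) (sub _))] at h1
    have h2 : (S₁ ∪ T₁).card ≤ n := (card_le_card (union_subset (sub _) (sub _))).trans hM.card_le
    have h3 : (((univ.filter fun c => ¬ ((eBip (G c) (S₀.image fun e => e 0)
        (T₀.image fun e => e 1) : ℝ) ≤ η * (n : ℝ) ^ 2 ∨
        (eBip (G c) (S₀.image fun e => e 0) (T₀.image fun e => e 1)ᶜ : ℝ)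
          ≤ η * (n : ℝ) ^ 2)).card : ℕ) : ℝ) ≤ (n : ℝ) - (S₁ ∪ T₁).card := by
      rw [← Nat.cast_sub h2]; exact_mod_cast h1
    linarith

/-- A matching containing enough disjoint absorbers for every triple extends to a perfect
matching. -/
lemma exists_perfect_of_absorbers {n : ℕ} {H : (Fin 3 → Fin n) → Prop} (r : ℕ) :
    ∀ (M : Finset (Fin 3 → Fin n)) (S : Finset (Fin 4 → Fin 3 → Fin n)), IsMatch H M →
      M.card + r = n → (∀ q ∈ S, ∀ i, q i ∈ M) →
      (∀ q ∈ S, ∀ q' ∈ S, q ≠ q' → ¬ Meets q q') →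
      (∀ t, r ≤ (S.filter fun q => IsAbsorber H t q).card) →
      ∃ M', IsMatch H M' ∧ M'.card = n := by
  induction r with
  | zero => exact fun M S hM hcard _ _ _ => ⟨M, hM, hcard⟩
  | succ r ih =>
    intro M S hM hcard hSM hS habs
    have hex : ∀ j, ∃ v, ∀ e ∈ M, v ≠ e j := fun j => by
      obtain ⟨v, hv, -⟩ := exists_unmatched hM j ∅ (by simp; omega)
      exact ⟨v, hv⟩
    choose t ht using hex
    obtain ⟨q, hq⟩ : (S.filter fun q => IsAbsorber H t q).Nonempty :=
      card_pos.1 (by have := habs t; omega)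
    rw [mem_filter] at hq
    obtain ⟨hqS, hinj, hqH, σ, hσ⟩ := hq
    have hqinj : Function.Injective q := by
      intro i i' h
      have h2 := hinj 0 (a₁ := i.succ) (a₂ := i'.succ) (by simp [extend, h])
      simpa using h2
    have hRM : univ.image q ⊆ M := by
      intro e he
      obtain ⟨i, -, rfl⟩ := mem_image.1 he
      exact hSM q hqS i
    obtain ⟨h1, h2⟩ := hM.replace hRM (fun s j => extend t q (σ j s) j) hσ
      (fun j => (hinj j).comp (σ j).injective) (by
        intro s j
        generalize σ j s = i
        induction i using Fin.cases with
        | zero => exact Or.inr (ht j)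
        | succ i => exact Or.inl ⟨q i, mem_image_of_mem q (mem_univ i), rfl⟩)
    rw [card_image_of_injective _ hqinj, card_univ, Fintype.card_fin] at h2
    refine ih _ (S.erase q) h1 (by omega) ?_ ?_ ?_
    · intro q' hq' i
      rw [mem_erase] at hq'
      refine mem_union_left _ (mem_sdiff.2 ⟨hSM q' hq'.2 i, fun h => ?_⟩)
      obtain ⟨i', -, h'⟩ := mem_image.1 h
      exact hS q hqS q' hq'.2 (Ne.symm hq'.1) ⟨i', i, 0, congrFun h' 0⟩
    · intro a ha b hb
      exact hS a (mem_of_mem_erase ha) b (mem_of_mem_erase hb)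
    · intro t'
      have h3 := habs t'
      rw [filter_erase]
      have := pred_card_le_card_erase (s := S.filter fun q => IsAbsorber H t' q) (a := q)
      omega

lemma exists_transversal_of_perfect {n : ℕ} {G : Fin n → Fin n → Fin n → Prop}
    {M : Finset (Fin 3 → Fin n)} (hM : IsMatch (colorGraph G) M) (hcard : M.card = n) :
    ∃ f φ : Fin n ≃ Fin n, ∀ v : Fin n, G (φ v) v (f v) := by
  have h : ∀ v, ∃ e ∈ M, e 0 = v := by
    intro v
    have h1 : M.image (fun e => e 0) = univ := by
      rw [← card_eq_iff_eq_univ, hM.card_image 0 subset_rfl, hcard, Fintype.card_fin]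
    have h2 : v ∈ M.image (fun e => e 0) := by rw [h1]; exact mem_univ v
    simpa using h2
  choose e he hev using h
  have hinj : ∀ j, Function.Injective fun v => e v j := by
    intro j v v' hvv
    rw [← hev v, ← hev v', hM.2 j _ (he v) _ (he v') hvv]
  refine ⟨Equiv.ofBijective _ (Finite.injective_iff_bijective.1 (hinj 1)),
    Equiv.ofBijective _ (Finite.injective_iff_bijective.1 (hinj 2)), fun v => ?_⟩
  have := hM.1 _ (he v)
  simpa [colorGraph, hev] using this

/-- Collections with large degrees have a transversal perfect matching unless they are commonly
extremal. -/
lemma exists_transversal_or_commonExtremal (η : ℝ) (hη : 0 < η) :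
    ∃ μ0 : ℝ, 0 < μ0 ∧ ∀ μ : ℝ, 0 < μ → μ ≤ μ0 →
    ∃ d0 : ℝ, 0 < d0 ∧ ∀ d : ℝ, d ≤ d0 →
    ∃ n0 : ℕ, ∀ n : ℕ, n0 ≤ n → ∀ G : Fin n → Fin n → Fin n → Prop,
    (∀ i, ((univ.filter fun v => (dR (G i) v : ℝ) < (1/2 - μ) * n).card : ℝ) ≤ d * n) →
    (∀ i, ((univ.filter fun w => (dL (G i) w : ℝ) < (1/2 - μ) * n).card : ℝ) ≤ d * n) →
    (∀ v, ((univ.filter fun i => (dR (G i) v : ℝ) < (1/2 - μ) * n).card : ℝ) ≤ d * n) →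
    (∀ w, ((univ.filter fun i => (dL (G i) w : ℝ) < (1/2 - μ) * n).card : ℝ) ≤ d * n) →
    (∃ f φ : Fin n ≃ Fin n, ∀ v : Fin n, G (φ v) v (f v)) ∨ commonExtremal η G := by
  obtain ⟨β, hβ0, hβ1, hβ2, hβ3⟩ : ∃ β : ℝ, 0 < β ∧ β ≤ 1/100 ∧ 79 * β ≤ η ∧ 27 * β ≤ η ^ 2 := by
    refine ⟨min (1/100) (min (η / 79) (η ^ 2 / 27)), by positivity, min_le_left _ _, ?_, ?_⟩
    · have := (min_le_right (1/100) (min (η / 79) (η ^ 2 / 27))).trans (min_le_left _ _)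
      linarith
    · have := (min_le_right (1/100) (min (η / 79) (η ^ 2 / 27))).trans (min_le_right _ _)
      linarith
  refine ⟨min (β / 2) (η / 4), by positivity, fun μ hμ hμ0 => ?_⟩
  obtain ⟨hμβ, hμη⟩ := le_min_iff.1 hμ0
  obtain ⟨κ, hκ, n₁, hn₁⟩ := exists_absorbing_family (β ^ 6 / 6) (η / 32) (by positivity)
    (by positivity)
  refine ⟨min μ (κ / 2), by positivity, fun d hd0 => ?_⟩
  obtain ⟨hdμ, hdκ⟩ := le_min_iff.1 hd0
  obtain ⟨n₂, hn₂⟩ := exists_nat_ge (max (450 / β ^ 6) (max (8 / κ) (2 / η)))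
  refine ⟨max n₁ (max n₂ 1), fun n hn G hGR hGL hR hL => ?_⟩
  have hn0 : 0 < n := by omega
  have hn' : (0 : ℝ) < n := by exact_mod_cast hn0
  have hn3 : max (450 / β ^ 6) (max (8 / κ) (2 / η)) ≤ n :=
    hn₂.trans (by exact_mod_cast (by omega : n₂ ≤ n))
  simp only [max_le_iff] at hn3
  obtain ⟨hnβ, hnκ, hnη⟩ := hn3
  rw [div_le_iff₀ (by positivity)] at hnβ hnκ hnη
  have hlayer : ∀ k z, (1/2 - 2 * μ) * (n : ℝ) ^ 3 ≤ (layer (colorGraph G) k z).card := by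
    intro k z
    obtain rfl | rfl | rfl : k = 0 ∨ k = 1 ∨ k = 2 := by omega
    · rw [card_layer_zero hn0]
      exact sum_lower_bound (fun c => dR (G c) z) μ d hμ.le (by linarith) hdμ (hR z)
    · rw [card_layer_one hn0]
      exact sum_lower_bound (fun c => dL (G c) z) μ d hμ.le (by linarith) hdμ (hL z)
    · rw [card_layer_two hn0]
      exact sum_lower_bound (fun v => dR (G z) v) μ d hμ.le (by linarith) hdμ (hGR z)
  rcases linked_pair_or_parity hn0 (colorGraph G) (2 * μ) β (by positivity) (by linarith) hlayer
    with ⟨k, l, m, hkl, hkm, hlm, hk, hl⟩ | ⟨x, y, z, hxyz, hH⟩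
  · have hlayer' : ∀ k z, 1/3 * (n : ℝ) ^ 3 ≤ (layer (colorGraph G) k z).card := fun k z =>
      le_trans (by gcongr; linarith) (hlayer k z)
    obtain ⟨S, hScard, hSV, hSc, hSabs⟩ := hn₁ n (by omega) (colorGraph G)
      (le_card_isAbsorber _ hkl hkm hlm β hβ0 (by linarith) hk hl hlayer' (by linarith))
    set A := S.biUnion fun q => univ.image q with hA
    have hAmem : ∀ e ∈ A, ∃ q ∈ S, ∃ i, q i = e := by
      intro e he
      simpa [hA] using he
    have hAmatch : IsMatch (colorGraph G) A := by
      refine ⟨fun e he => ?_, fun j e he e' he' h => ?_⟩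
      · obtain ⟨q, hq, i, rfl⟩ := hAmem e he
        exact (hSV q hq).1 i
      · obtain ⟨q, hq, i, rfl⟩ := hAmem e he
        obtain ⟨q', hq', i', rfl⟩ := hAmem e' he'
        by_cases hqq : q = q'
        · subst hqq
          rw [(hSV q hq).2 j h]
        · exact absurd ⟨i, i', j, h⟩ (hSc q hq q' hq' hqq)
    have hAcard : (A.card : ℝ) ≤ η / 8 * n := by
      have h1 : A.card ≤ S.card * 4 := card_biUnion_le_card_mul _ _ _ fun q _ =>
        card_image_le.trans (by simp)
      rify at h1
      linarith
    rcases nearly_perfect_or_commonExtremal G η μ d κ (η / 8) (by linarith) hμ.le (by positivity)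
      (by linarith) (by nlinarith) hR hL A hAmatch hAcard with ⟨M, hM, hAM, hMcard⟩ | h
    · left
      obtain ⟨M', hM', hM'card⟩ := exists_perfect_of_absorbers (n - M.card) M S hM
        (by have := hM.card_le; omega) (fun q hq i => hAM (by
          rw [hA, mem_biUnion]; exact ⟨q, hq, mem_image_of_mem q (mem_univ i)⟩)) hSc (by
          intro t
          have h1 := hMcard.trans (hSabs t)
          rw [← Nat.cast_sub hM.card_le] at h1
          exact_mod_cast h1)
      exact exists_transversal_of_perfect hM' hM'card
    · exact Or.inr h
  · have hβn : ∀ s t : Finset (Fin n), s ⊆ t → (t.card : ℝ) ≤ d * n → (s.card : ℝ) ≤ β * n := by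
      intro s t hst ht
      have h1 : (s.card : ℝ) ≤ t.card := by exact_mod_cast card_le_card hst
      have h2 : d * n ≤ β * n := by gcongr; linarith
      linarith
    have hmono : ∀ f : Fin n → ℕ, (univ.filter fun v => (f v : ℝ) < (1/2 - β) * n) ⊆
        univ.filter fun v => (f v : ℝ) < (1/2 - μ) * n := by
      intro f v hv
      simp only [mem_filter, mem_univ, true_and] at hv ⊢
      refine hv.trans_le ?_
      gcongr
      linarith
    exact Or.inr (commonExtremal_of_parity hn0 G η β hβ1 hη hβ2 hβ3 x y z hxyz hH
      (fun c => hβn _ _ (hmono _) (hGR c)) (fun c => hβn _ _ (hmono _) (hGL c)))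

lemma dRin_eq {n : ℕ} (G : Fin n → Fin n → Prop) (v : Fin n) (S : Finset (Fin n)) :
    dRin G v S = (S.filter fun w => G v w).card := by
  rw [dRin, Nat.card_eq_fintype_card, Fintype.card_subtype]
  congr 1
  ext w
  simp

/-- Vertices whose neighbourhoods cover nearly all of `S` force many edges into `Z`. -/
lemma card_mul_card_inter_le {n : ℕ} {G : Fin n → Fin n → Prop} {ε η : ℝ}
    {X P Z S : Finset (Fin n)} (hε : 0 ≤ ε) (hS : (S.card : ℝ) = (1/2 - ε) * n)
    (hd : ∀ v ∈ P, (1/2 - 2*ε) * (n : ℝ) ≤ dRin G v S)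
    (he : (eBip G X Z : ℝ) ≤ η * (n : ℝ) ^ 2) :
    ((X ∩ P).card : ℝ) * ((Z ∩ S).card : ℝ) ≤ (ε + η) * (n : ℝ) ^ 2 := by
  have h1 : ((X ∩ P).card : ℝ) * ((Z ∩ S).card - ε * n) ≤ eBip G X Z := by
    have h2 : ∑ v ∈ X ∩ P, ((Z ∩ S).filter fun w => G v w).card ≤ eBip G X Z := by
      rw [eBip_eq, ← card_sigma]
      refine card_le_card_of_injOn (fun p => (p.1, p.2)) ?_ ?_
      · rintro ⟨v, w⟩ h
        simp only [coe_sigma, Set.mem_sigma_iff, mem_coe, mem_filter, mem_inter] at h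
        simp [h.1.1, h.2.1.1, h.2.2]
      · rintro ⟨v, w⟩ - ⟨v', w'⟩ - h
        simp only [Prod.mk.injEq] at h
        simp [h.1, h.2]
    have h3 : ∀ v ∈ X ∩ P,
        ((Z ∩ S).card : ℝ) - ε * n ≤ ((Z ∩ S).filter fun w => G v w).card := by
      intro v hv
      have h4 := hd v (mem_inter.1 hv).2
      rw [dRin_eq] at h4
      have h5 : (Z ∩ S).card + (S.filter fun w => G v w).card ≤
          S.card + ((Z ∩ S).filter fun w => G v w).card := by
        rw [← card_union_add_card_inter]
        refine add_le_add (card_le_card ?_) (card_le_card ?_)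
        · exact union_subset inter_subset_right (filter_subset _ _)
        · intro w hw
          simp only [mem_inter, mem_filter] at hw ⊢
          exact ⟨hw.1, hw.2.2⟩
      have h6 : ((Z ∩ S).card : ℝ) + (S.filter fun w => G v w).card ≤
          S.card + ((Z ∩ S).filter fun w => G v w).card := by exact_mod_cast h5
      linarith
    calc _ = ∑ v ∈ X ∩ P, (((Z ∩ S).card : ℝ) - ε * n) := by
          rw [sum_const, nsmul_eq_mul]
      _ ≤ ∑ v ∈ X ∩ P, (((Z ∩ S).filter fun w => G v w).card : ℝ) := sum_le_sum h3
      _ ≤ _ := by exact_mod_cast h2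
  have h7 : ((X ∩ P).card : ℝ) ≤ n := by
    have := card_le_univ (X ∩ P)
    rw [Fintype.card_fin] at this
    exact_mod_cast this
  have h8 : ((X ∩ P).card : ℝ) * (ε * n) ≤ n * (ε * n) := by gcongr
  nlinarith

lemma card_symmDiff_eq {α : Type*} [DecidableEq α] (S T : Finset α) :
    ((S ∆ T).card : ℝ) = S.card + T.card - 2 * (T ∩ S).card := by
  have h1 : (S ∆ T).card = (S \ T).card + (T \ S).card :=
    card_union_of_disjoint disjoint_sdiff_sdiff
  have h2 := card_sdiff_add_card_inter S T
  have h3 := card_sdiff_add_card_inter T S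
  rw [inter_comm] at h2
  rw [h1, ← h2, ← h3]
  push_cast
  ring

lemma card_symmDiff_triangle {α : Type*} [DecidableEq α] (S T U : Finset α) :
    ((S ∆ U).card : ℝ) ≤ (S ∆ T).card + (U ∆ T).card := by
  have h : S ∆ U ⊆ S ∆ T ∪ U ∆ T := by
    rw [symmDiff_comm U T]
    exact symmDiff_triangle S T U
  exact_mod_cast (card_le_card h).trans (card_union_le _ _)

lemma card_symmDiff_compl_le {n : ℕ} {A B C X : Finset (Fin n)} {a b : ℝ}
    (hU : A ∪ B ∪ C = univ) (hn : A.card + B.card + C.card = n) (hC : (C.card : ℝ) ≤ a)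
    (h : ((B ∆ X).card : ℝ) ≤ b) : ((A ∆ Xᶜ).card : ℝ) ≤ a + b := by
  have hd : Disjoint A B := by
    have h1 := card_union_le (A ∪ B) C
    rw [hU, card_univ, Fintype.card_fin] at h1
    have h2 := card_union_add_card_inter A B
    rw [disjoint_iff_inter_eq_empty, ← card_eq_zero]
    omega
  have hs : A ∆ Xᶜ ⊆ C ∪ B ∆ X := by
    intro v hv
    have h1 : v ∈ A ∪ B ∪ C := hU ▸ mem_univ v
    have h2 : v ∈ A → v ∉ B := fun h => disjoint_left.1 hd h
    simp only [mem_symmDiff, mem_compl, mem_union] at *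
    tauto
  have h3 : ((A ∆ Xᶜ).card : ℝ) ≤ C.card + (B ∆ X).card := by
    exact_mod_cast (card_le_card hs).trans (card_union_le _ _)
  linarith

lemma card_le_card_inter_add {n : ℕ} {A B C : Finset (Fin n)} (hU : A ∪ B ∪ C = univ)
    (X : Finset (Fin n)) :
    (X.card : ℝ) ≤ (X ∩ A).card + (X ∩ B).card + C.card := by
  have h : X ⊆ X ∩ A ∪ X ∩ B ∪ C := by
    intro v hv
    have h1 : v ∈ A ∪ B ∪ C := hU ▸ mem_univ v
    simp only [mem_union, mem_inter] at *
    tauto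
  have h2 := card_union_le (X ∩ A ∪ X ∩ B) C
  have h3 := card_union_le (X ∩ A) (X ∩ B)
  exact_mod_cast (card_le_card h).trans (by omega)

/-- A sparse pair of half-sized sets determines the characteristic partition up to a small error
and up to swapping its two halves. -/
lemma isCharPart.near {n : ℕ} {G : Fin n → Fin n → Prop} {ε η : ℝ}
    {A1 B1 C1 A2 B2 C2 X Z : Finset (Fin n)} (hn : 0 < n)
    (hP : isCharPart ε G A1 B1 C1 A2 B2 C2) (hε : 0 < ε) (hε' : ε ≤ 1/100) (hηε : η ≤ ε)
    (hX : (1/2 - η) * (n : ℝ) ≤ X.card)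
    (hZ : (1/2 - η) * (n : ℝ) ≤ Z.card) (he : (eBip G X Z : ℝ) ≤ η * (n : ℝ) ^ 2) :
    (((A1 ∆ X).card : ℝ) ≤ 28 * ε * n ∧ ((B1 ∆ Xᶜ).card : ℝ) ≤ 28 * ε * n) ∨
    (((A1 ∆ Xᶜ).card : ℝ) ≤ 28 * ε * n ∧ ((B1 ∆ X).card : ℝ) ≤ 28 * ε * n) := by
  obtain ⟨⟨hU1, hN1⟩, ⟨hU2, hN2⟩, hA1, hB1, hC1, hA2, hB2, hC2, -, -, hdA, hdB, -⟩ := hP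
  have hn' : (0 : ℝ) < n := by exact_mod_cast hn
  have hA := card_mul_card_inter_le hε.le hA2 hdA he
  have hB := card_mul_card_inter_le hε.le hB2 hdB he
  have hXs := card_le_card_inter_add hU1 X
  have hZs := card_le_card_inter_add hU2 Z
  have hηn : η * n ≤ ε * n := by gcongr
  have hεn : ε * n ≤ 1/100 * n := by gcongr
  have hεn0 : 0 < ε * n := by positivity
  have hsum : (0 : ℝ) ≤ (Z ∩ A2).card ∧ (0 : ℝ) ≤ (Z ∩ B2).card := by
    constructor <;> positivity
  have hηn2 : (ε + η) * (n : ℝ) ^ 2 ≤ 2 * (ε * n) * n := by nlinarith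
  have hor : ((X ∩ B1).card : ℝ) ≤ 10 * ε * n ∨ ((X ∩ A1).card : ℝ) ≤ 10 * ε * n := by
    by_contra! hcon
    have h1 : 10 * (ε * n) * ((Z ∩ A2).card : ℝ) ≤ 2 * (ε * n) * n := by
      nlinarith [mul_le_mul_of_nonneg_right hcon.2.le hsum.1]
    have h2 : 10 * (ε * n) * ((Z ∩ B2).card : ℝ) ≤ 2 * (ε * n) * n := by
      nlinarith [mul_le_mul_of_nonneg_right hcon.1.le hsum.2]
    have h3 : ((Z ∩ A2).card : ℝ) ≤ 1/5 * n := by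
      refine le_of_mul_le_mul_left ?_ hεn0
      linarith
    have h4 : ((Z ∩ B2).card : ℝ) ≤ 1/5 * n := by
      refine le_of_mul_le_mul_left ?_ hεn0
      linarith
    linarith
  have hsA := card_symmDiff_eq A1 X
  have hsB := card_symmDiff_eq B1 X
  rcases hor with h | h
  · left
    have h1 : ((A1 ∆ X).card : ℝ) ≤ 26 * ε * n := by linarith
    have hU1' : B1 ∪ A1 ∪ C1 = univ := by rw [union_comm B1 A1, hU1]
    have h2 := card_symmDiff_compl_le hU1' (by omega) hC1.le h1
    constructor <;> linarith
  · right
    have h1 : ((B1 ∆ X).card : ℝ) ≤ 26 * ε * n := by linarith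
    have h2 := card_symmDiff_compl_le hU1 hN1 hC1.le h1
    constructor <;> linarith

/-- Stability rules out common extremality. -/
lemma not_commonExtremal_of_stable {n : ℕ} {G : Fin n → Fin n → Fin n → Prop}
    {A1 B1 C1 A2 B2 C2 : Fin n → Finset (Fin n)} {α γ δ ε η : ℝ} (hn : 0 < n) (hη : 0 < η)
    (hηα : η < α) (hηγ : η < γ) (hηδ : η < δ) (hηε : η ≤ ε) (hε : ε ≤ 1/100)
    (hεδ : 100 * ε ≤ δ)
    (hP : ∀ i, isExtremal ε (G i) →
      isCharPart ε (G i) (A1 i) (B1 i) (C1 i) (A2 i) (B2 i) (C2 i))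
    (hst : γ * (n : ℝ) ≤ ((univ.filter (fun i : Fin n => isNice α (G i))).card : ℝ) ∨
     2 * δ * (n : ℝ) ^ 2 ≤ (Nat.card {p : Fin n × Fin n //
        isExtremal ε (G p.1) ∧ isExtremal ε (G p.2) ∧
        δ * (n : ℝ) ≤ ((A1 p.1 ∆ A1 p.2).card : ℝ) ∧
        δ * (n : ℝ) ≤ ((A1 p.1 ∆ B1 p.2).card : ℝ)} : ℝ)) :
    ¬ commonExtremal η G := by
  rintro ⟨X, Y, ⟨hX, -⟩, ⟨hY, hY'⟩, hE⟩
  have hn' : (0 : ℝ) < n := by exact_mod_cast hn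
  have hYc : (1/2 - η) * (n : ℝ) ≤ Yᶜ.card := by
    have h1 := card_add_card_compl Y
    rw [Fintype.card_fin] at h1
    have h2 : (Y.card : ℝ) + Yᶜ.card = n := by exact_mod_cast h1
    linarith
  set E := univ.filter fun c => ¬ ((eBip (G c) X Y : ℝ) ≤ η * (n : ℝ) ^ 2 ∨
    (eBip (G c) X Yᶜ : ℝ) ≤ η * (n : ℝ) ^ 2) with hEdef
  rcases hst with hst | hst
  · have hsub : univ.filter (fun i : Fin n => isNice α (G i)) ⊆ E := by
      intro c hc
      simp only [hEdef, mem_filter, mem_univ, true_and] at hc ⊢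
      have hαn : (1/2 - α) * (n : ℝ) ≤ (1/2 - η) * n := by gcongr
      have h1 := hc X Y (hαn.trans hX) (hαn.trans hY)
      have h2 := hc X Yᶜ (hαn.trans hX) (hαn.trans hYc)
      have h3 : η * (n : ℝ) ^ 2 < α * (n : ℝ) ^ 2 := by gcongr
      rintro (h | h) <;> linarith
    have h1 : ((univ.filter (fun i : Fin n => isNice α (G i))).card : ℝ) ≤ E.card := by
      exact_mod_cast card_le_card hsub
    have h2 : η * (n : ℝ) < γ * n := by gcongr
    linarith
  · have hnear : ∀ c, isExtremal ε (G c) → c ∉ E →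
        (((A1 c ∆ X).card : ℝ) ≤ 28 * ε * n ∧ ((B1 c ∆ Xᶜ).card : ℝ) ≤ 28 * ε * n) ∨
        (((A1 c ∆ Xᶜ).card : ℝ) ≤ 28 * ε * n ∧ ((B1 c ∆ X).card : ℝ) ≤ 28 * ε * n) := by
      intro c hc hcE
      simp only [hEdef, mem_filter, mem_univ, true_and, not_not] at hcE
      rcases hcE with h | h
      · exact (hP c hc).near hn (by linarith) hε hηε hX hY h
      · exact (hP c hc).near hn (by linarith) hε hηε hX hYc h
    have hεn : 56 * ε * n < δ * n := by
      have : 56 * ε < δ := by linarith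
      gcongr
    have hsub : (univ.filter fun p : Fin n × Fin n =>
        isExtremal ε (G p.1) ∧ isExtremal ε (G p.2) ∧
        δ * (n : ℝ) ≤ ((A1 p.1 ∆ A1 p.2).card : ℝ) ∧
        δ * (n : ℝ) ≤ ((A1 p.1 ∆ B1 p.2).card : ℝ)) ⊆ E ×ˢ univ ∪ univ ×ˢ E := by
      rintro ⟨a, b⟩ h
      simp only [mem_filter, mem_univ, true_and] at h
      obtain ⟨ha, hb, hAA, hAB⟩ := h
      by_contra hcon
      simp only [mem_union, mem_product, mem_univ, and_true, true_and, not_or] at hcon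
      have h1 := card_symmDiff_triangle (A1 a) X (A1 b)
      have h2 := card_symmDiff_triangle (A1 a) Xᶜ (A1 b)
      have h3 := card_symmDiff_triangle (A1 a) X (B1 b)
      have h4 := card_symmDiff_triangle (A1 a) Xᶜ (B1 b)
      rcases hnear a ha hcon.1 with h | h <;> rcases hnear b hb hcon.2 with h' | h' <;>
        linarith
    have h1 := (card_le_card hsub).trans (card_union_le _ _)
    rw [card_product, card_product, card_univ, Fintype.card_fin] at h1
    rw [Nat.card_eq_fintype_card, Fintype.card_subtype] at hst
    have h2 : 2 * δ * (n : ℝ) ^ 2 ≤ E.card * n + n * E.card := hst.trans (by exact_mod_cast h1)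
    have h3 : (E.card : ℝ) * n ≤ η * n * n := by gcongr
    have h4 : η * (n : ℝ) ^ 2 < δ * (n : ℝ) ^ 2 := by gcongr
    nlinarith

/-- **Stability theorem for transversal perfect matchings** (Theorem on stable
bipartite collections).  For `0 < 1/n ≪ d ≪ μ ≪ α ≪ γ, ε ≪ δ ≪ 1`: suppose
`𝒢 = {G 1, …, G n}` is a collection of bipartite graphs on `V₁ ∪ V₂` (sides of size
`n`), with a fixed characteristic partition chosen for every `ε`-extremal member, such
that (i) `𝒢` is `(γ,α,ε,δ)`-stable — at least `γn` of the graphs are `α`-nice, or the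
cross graph (counted here via ordered pairs, each unordered edge counting twice) has at
least `δn²` edges; (ii) for every colour `i`, all but at most `dn` vertices `x` satisfy
`d_{Gᵢ}(x) ≥ (1/2 − μ)n`; and (iii) for every vertex `x`, `d_{Gᵢ}(x) ≥ (1/2 − μ)n` for
all but at most `dn` colours `i`.  Then `𝒢` contains a transversal perfect matching:
a bijection `f : V₁ ≃ V₂` together with a colour bijection `φ` with
`(v, f v) ∈ G (φ v)` for every `v`. -/
theorem stable_transversal_perfect_matching :
    ∃ δ0 : ℝ, 0 < δ0 ∧ ∀ δ : ℝ, 0 < δ → δ ≤ δ0 →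
    ∃ c1 : ℝ, 0 < c1 ∧ ∀ γ ε : ℝ, 0 < γ → γ ≤ c1 → 0 < ε → ε ≤ c1 →
    ∃ α0 : ℝ, 0 < α0 ∧ ∀ α : ℝ, 0 < α → α ≤ α0 →
    ∃ μ0 : ℝ, 0 < μ0 ∧ ∀ μ : ℝ, 0 < μ → μ ≤ μ0 →
    ∃ d0 : ℝ, 0 < d0 ∧ ∀ d : ℝ, 0 < d → d ≤ d0 →
    ∃ n0 : ℕ, ∀ n : ℕ, n0 ≤ n →
    ∀ G : Fin n → Fin n → Fin n → Prop,
    ∀ A1 B1 C1 A2 B2 C2 : Fin n → Finset (Fin n),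
    (∀ i, isExtremal ε (G i) →
      isCharPart ε (G i) (A1 i) (B1 i) (C1 i) (A2 i) (B2 i) (C2 i)) →
    (γ * (n : ℝ) ≤ ((univ.filter (fun i : Fin n => isNice α (G i))).card : ℝ) ∨
     2 * δ * (n : ℝ) ^ 2 ≤ (Nat.card {p : Fin n × Fin n //
        isExtremal ε (G p.1) ∧ isExtremal ε (G p.2) ∧
        δ * (n : ℝ) ≤ ((A1 p.1 ∆ A1 p.2).card : ℝ) ∧
        δ * (n : ℝ) ≤ ((A1 p.1 ∆ B1 p.2).card : ℝ)} : ℝ)) →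
    (∀ i : Fin n,
      (((univ.filter (fun v : Fin n => (dR (G i) v : ℝ) < (1/2 - μ) * n)).card +
        (univ.filter (fun w : Fin n => (dL (G i) w : ℝ) < (1/2 - μ) * n)).card : ℝ)
          ≤ d * n)) →
    (∀ v : Fin n,
      ((univ.filter (fun i : Fin n => (dR (G i) v : ℝ) < (1/2 - μ) * n)).card : ℝ)
        ≤ d * n) →
    (∀ w : Fin n,
      ((univ.filter (fun i : Fin n => (dL (G i) w : ℝ) < (1/2 - μ) * n)).card : ℝ)
        ≤ d * n) →
    ∃ f φ : Fin n ≃ Fin n, ∀ v : Fin n, G (φ v) v (f v) := by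
  refine ⟨1, one_pos, fun δ hδ _ => ⟨min (1/100) (δ/100), by positivity, ?_⟩⟩
  intro γ ε hγ _ hε hε'
  refine ⟨1, one_pos, fun α hα _ => ?_⟩
  obtain ⟨η, hη, hηα, hηγ, hηδ, hηε⟩ :
      ∃ η : ℝ, 0 < η ∧ η < α ∧ η < γ ∧ η < δ ∧ η ≤ ε := by
    refine ⟨min (min (α/2) (γ/2)) (min (δ/2) ε), by positivity, ?_, ?_, ?_, ?_⟩
    · exact (min_le_left _ _).trans_lt ((min_le_left _ _).trans_lt (half_lt_self hα))
    · exact (min_le_left _ _).trans_lt ((min_le_right _ _).trans_lt (half_lt_self hγ))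
    · exact (min_le_right _ _).trans_lt ((min_le_left _ _).trans_lt (half_lt_self hδ))
    · exact (min_le_right _ _).trans (min_le_right _ _)
  obtain ⟨μ0, hμ0, H⟩ := exists_transversal_or_commonExtremal η hη
  refine ⟨μ0, hμ0, fun μ hμ hμ' => ?_⟩
  obtain ⟨d0, hd0, H⟩ := H μ hμ hμ'
  refine ⟨d0, hd0, fun d _ hd => ?_⟩
  obtain ⟨n0, H⟩ := H d hd
  refine ⟨max n0 1, fun n hn G A1 B1 C1 A2 B2 C2 hP hst hv hR hL => ?_⟩
  refine (H n (le_of_max_le_left hn) G (fun i => ?_) (fun i => ?_) hR hL).resolve_right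
    (not_commonExtremal_of_stable (le_of_max_le_right hn) hη hηα hηγ hηδ hηε
      (hε'.trans (min_le_left _ _)) ?_ hP hst)
  · exact (le_add_of_nonneg_right (Nat.cast_nonneg _)).trans (hv i)
  · exact (le_add_of_nonneg_left (Nat.cast_nonneg _)).trans (hv i)
  · have := hε'.trans (min_le_right _ _)
    linarith
end
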